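/- There exist universal constants C, β > 0 with the following property. Let (D, ν) be a probability space and {ψ_n}_{1≤n≤K} a bounded orthonormal system on D with uniform bound L. Let ξ^(1), …, ξ^(M) be sample points drawn independently from ν, and let Ψ be the M×K random matrix with entries Ψ_{ij} = ψ_j(ξ^(i)). If δ ∈ (0,1), s ≥ 2, and M ≥ C δ^{−2} L² s (log(s))³ log(K), then with probability at least 1 − K^{−β (log(s))³} the restricted isometry constant δ_s of (1/√M)Ψ satisfies δ_s ≤ δ. -/

import Mathlib

open Finset MeasureTheory

/-- Squared Euclidean (ℓ₂) norm. -/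
noncomputable def l2sq {n : Type*} [Fintype n] (x : n → ℝ) : ℝ := ∑ i, (x i) ^ 2

/-- ℓ₀ "norm": number of nonzero entries. -/
noncomputable def l0 {n : Type*} [Fintype n] (x : n → ℝ) : ℕ := Set.ncard {i | x i ≠ 0}

theorem one_add_pow_le (p : ℕ) (hp : 1 ≤ p) (x : ℝ) :
    (1 + x) ^ (2 * p) - 2 * p * x ≤ (1 + 9 * p * x ^ 2) ^ p := by
  have hp' : (1 : ℝ) ≤ p := by exact_mod_cast hp
  have bern : ∀ y : ℝ, 0 ≤ y → 1 + p * y ≤ (1 + y) ^ p := fun y hy =>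
    one_add_mul_le_pow (by linarith) p
  rcases le_total (2 * p * |x|) 1 with h | h
  · have h1 : |2 * p * x| ≤ 1 := by
      rw [abs_mul, abs_of_nonneg (by positivity)]; exact h
    have h2 := Real.abs_exp_sub_one_sub_id_le h1
    have h3 : (1 + x) ^ (2 * p) ≤ Real.exp (2 * p * x) := by
      have h4 : |x| ≤ 1 := by nlinarith [abs_nonneg x]
      have h5 : 0 ≤ 1 + x := by linarith [neg_abs_le x]
      calc (1 + x) ^ (2 * p) ≤ (Real.exp x) ^ (2 * p) := by
            gcongr; linarith [Real.add_one_le_exp x]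
        _ = _ := by rw [← Real.exp_nat_mul]; push_cast; ring_nf
    have h6 := bern (9 * p * x ^ 2) (by positivity)
    have h7 := (abs_le.1 h2).2
    have : 0 ≤ (p : ℝ) ^ 2 * x ^ 2 := by positivity
    nlinarith
  · have hx : |x| ≤ 2 * p * x ^ 2 := by
      have := mul_le_mul_of_nonneg_left h (abs_nonneg x)
      rw [← sq_abs]; nlinarith
    have h1 : (1 + x) ^ (2 * p) ≤ (1 + 5 * p * x ^ 2) ^ p := by
      rw [pow_mul]
      gcongr
      have := le_abs_self x
      nlinarith [sq_nonneg x]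
    have h2 : (1 + 5 * p * x ^ 2) ^ p + p * (4 * p * x ^ 2) ≤ (1 + 9 * p * x ^ 2) ^ p := by
      set A := 1 + 5 * (p : ℝ) * x ^ 2 with hA
      have hA1 : 1 ≤ A := by rw [hA]; nlinarith [show 0 ≤ (p : ℝ) * x ^ 2 by positivity]
      have e : 1 + 9 * p * x ^ 2 = A * (1 + (4 * p * x ^ 2) / A) := by
        field_simp; rw [hA]; ring
      rw [e, mul_pow]
      have h3 := bern ((4 * p * x ^ 2) / A) (by positivity)
      have h4 : A ≤ A ^ p := le_self_pow₀ hA1 (by omega)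
      have h5 : A ^ p * ((4 * p * x ^ 2) / A) ≥ 4 * p * x ^ 2 := by
        calc 4 * p * x ^ 2 = A * ((4 * p * x ^ 2) / A) := by field_simp
          _ ≤ _ := by gcongr
      calc A ^ p + p * (4 * p * x ^ 2) ≤ A ^ p + p * (A ^ p * ((4 * p * x ^ 2) / A)) := by
            gcongr
        _ = A ^ p * (1 + p * ((4 * p * x ^ 2) / A)) := by ring
        _ ≤ _ := by gcongr
    have h3 : -x ≤ |x| := neg_le_abs x
    nlinarith

theorem add_pow_sub_le (p : ℕ) (hp : 1 ≤ p) (a b : ℝ) :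
    (a + b) ^ (2 * p) - 2 * p * a ^ (2 * p - 1) * b ≤ (a ^ 2 + 9 * p * b ^ 2) ^ p := by
  rcases eq_or_ne a 0 with rfl | ha
  · have : (0 : ℝ) ^ (2 * p - 1) = 0 := zero_pow (by omega)
    rw [this, pow_mul]
    have hp' : (1 : ℝ) ≤ p := by exact_mod_cast hp
    have : (0 + b) ^ 2 ≤ 0 ^ 2 + 9 * p * b ^ 2 := by nlinarith [sq_nonneg b]
    have := pow_le_pow_left₀ (sq_nonneg _) this p
    linarith
  · have h := one_add_pow_le p hp (b / a)
    have ha2 : 0 ≤ a ^ (2 * p) := by rw [pow_mul]; positivity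
    have h2 := mul_le_mul_of_nonneg_left h ha2
    have e1 : a ^ (2 * p) * (1 + 9 * p * (b / a) ^ 2) ^ p = (a ^ 2 + 9 * p * b ^ 2) ^ p := by
      rw [pow_mul, ← mul_pow]; congr 1; field_simp
    have e2 : a ^ (2 * p) * ((1 + b / a) ^ (2 * p) - 2 * p * (b / a)) =
        (a + b) ^ (2 * p) - 2 * p * a ^ (2 * p - 1) * b := by
      have : a ^ (2 * p) = a ^ (2 * p - 1) * a := by
        rw [← pow_succ]; congr 1; omega
      rw [mul_sub, ← mul_pow, this]
      congr 1
      · congr 1; field_simp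
      · field_simp
    linarith

theorem add_pow_le_succ_pow_mul (p k : ℕ) (hp : 1 ≤ p) (hk : 1 ≤ k) {a b : ℝ} (ha : 0 ≤ a)
    (hb : 0 ≤ b) :
    (a + b) ^ p ≤ ((k : ℝ) + 1) ^ (p - 1) * (a ^ p / (k : ℝ) ^ (p - 1) + b ^ p) := by
  have hk' : (0 : ℝ) < k := by exact_mod_cast hk
  obtain ⟨q, rfl⟩ : ∃ q, p = q + 1 := ⟨p - 1, by omega⟩
  have h := (convexOn_pow (𝕜 := ℝ) (q + 1)).2
    (show ((k : ℝ) + 1) / k * a ∈ Set.Ici 0 from Set.mem_Ici.2 (by positivity))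
    (show ((k : ℝ) + 1) * b ∈ Set.Ici 0 from Set.mem_Ici.2 (by positivity))
    (show (0 : ℝ) ≤ k / (k + 1) by positivity) (show (0 : ℝ) ≤ 1 / (k + 1) by positivity)
    (by field_simp)
  simp only [smul_eq_mul] at h
  refine (le_of_eq ?_).trans (h.trans (le_of_eq ?_))
  · congr 1; field_simp
  · simp only [Nat.add_sub_cancel, mul_pow, div_pow, pow_succ]; field_simp

theorem add_pow_two_mul_le (p : ℕ) (a b : ℝ) :
    (a + b) ^ (2 * p) ≤ 4 ^ p / 2 * (a ^ (2 * p) + b ^ (2 * p)) := by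
  rcases Nat.eq_zero_or_pos p with rfl | hp
  · norm_num
  have h := (Even.convexOn_pow (n := 2 * p) (𝕜 := ℝ) (by simp)).2 (Set.mem_univ (2 * a))
    (Set.mem_univ (2 * b)) (show (0 : ℝ) ≤ 1 / 2 by norm_num) (show (0 : ℝ) ≤ 1 / 2 by norm_num)
    (by norm_num)
  simp only [smul_eq_mul] at h
  have e : (2 : ℝ) ^ (2 * p) = 4 ^ p := by rw [pow_mul]; norm_num
  rw [mul_pow, mul_pow, e] at h
  refine (le_of_eq ?_).trans (h.trans (le_of_eq ?_))
  · congr 1; ring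
  · ring

theorem pow_sum_mul_le {A : Type*} [Fintype A] (w g : A → ℝ) (hw : ∀ a, 0 ≤ w a)
    (hw1 : ∑ a, w a = 1) (p : ℕ) :
    (∑ a, w a * g a) ^ (2 * p) ≤ ∑ a, w a * g a ^ (2 * p) := by
  have h := (Even.convexOn_pow (n := 2 * p) (𝕜 := ℝ) (by simp)).map_sum_le
    (t := univ) (w := w) (p := g) (fun i _ => hw i) hw1 (by simp)
  simpa using h

theorem exists_le_of_weighted_sum_le {A : Type*} [Fintype A] (w h : A → ℝ) (hw : ∀ a, 0 ≤ w a)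
    (hw1 : ∑ a, w a = 1) {R : ℝ} (hR : ∑ a, w a * h a ≤ R) : ∃ a, h a ≤ R := by
  by_contra! hc
  have h1 : ∑ a, w a * R < ∑ a, w a * h a := by
    apply Finset.sum_lt_sum
    · exact fun a _ => mul_le_mul_of_nonneg_left (hc a).le (hw a)
    · obtain ⟨a, ha⟩ : ∃ a, w a ≠ 0 := by
        by_contra! hz; simp [hz] at hw1
      exact ⟨a, mem_univ a, mul_lt_mul_of_pos_left (hc a) (lt_of_le_of_ne (hw a) (Ne.symm ha))⟩
  rw [← Finset.sum_mul, hw1] at h1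
  linarith

/-- One step of the greedy form of Maurey's empirical method. -/
theorem exists_sum_add_pow_le {ι A : Type*} [Fintype ι] [Fintype A] (w : A → ℝ)
    (hw : ∀ a, 0 ≤ w a) (hw1 : ∑ a, w a = 1) (Y : A → ι → ℝ) (hY : ∀ i, ∑ a, w a * Y a i = 0)
    (p : ℕ) (hp : 1 ≤ p) {m : ℝ} (hm : ∑ i, ∑ a, w a * Y a i ^ (2 * p) ≤ m) (k : ℕ)
    (F : ι → ℝ) (hF : ∑ i, F i ^ (2 * p) ≤ (9 * p * k) ^ p * m) :
    ∃ a, ∑ i, (F i + Y a i) ^ (2 * p) ≤ (9 * p * (k + 1)) ^ p * m := by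
  apply exists_le_of_weighted_sum_le w _ hw hw1
  have hm0 : 0 ≤ m := le_trans (Finset.sum_nonneg fun i _ => Finset.sum_nonneg fun a _ =>
    mul_nonneg (hw a) (by rw [pow_mul]; positivity)) hm
  have step : ∑ a, w a * ∑ i, (F i + Y a i) ^ (2 * p) ≤
      ∑ i, ∑ a, w a * (F i ^ 2 + 9 * p * Y a i ^ 2) ^ p := by
    simp only [Finset.mul_sum]
    rw [Finset.sum_comm]
    apply Finset.sum_le_sum
    intro i _
    have h0 : ∑ a, w a * (2 * p * F i ^ (2 * p - 1) * Y a i) = 0 := by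
      have : ∀ a, w a * (2 * p * F i ^ (2 * p - 1) * Y a i) =
        (2 * p * F i ^ (2 * p - 1)) * (w a * Y a i) := fun a => by ring
      simp only [this, ← Finset.mul_sum, hY, mul_zero]
    rw [← sub_zero (∑ a, _), ← h0, ← Finset.sum_sub_distrib]
    apply Finset.sum_le_sum
    intro a _
    have := mul_le_mul_of_nonneg_left (add_pow_sub_le p hp (F i) (Y a i)) (hw a)
    linarith
  refine step.trans ?_
  have e9 : ∀ y : ℝ, (9 * p * y ^ 2) ^ p = (9 * p) ^ p * y ^ (2 * p) := fun y => by
    rw [mul_pow, pow_mul]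
  rcases Nat.eq_zero_or_pos k with rfl | hk
  · have hF0 : ∀ i, F i ^ 2 = 0 := by
      have h1 : ∑ i, F i ^ (2 * p) ≤ 0 := by
        refine hF.trans (le_of_eq ?_)
        rw [Nat.cast_zero, mul_zero, zero_pow (by omega), zero_mul]
      intro i
      have h2 := (Finset.sum_eq_zero_iff_of_nonneg (fun i _ => by rw [pow_mul]; positivity)).1
        (le_antisymm h1 (Finset.sum_nonneg fun i _ => by rw [pow_mul]; positivity)) i (mem_univ i)
      have := pow_eq_zero_iff (by omega) |>.1 h2
      simp [this]
    simp only [hF0, zero_add, e9, Nat.cast_zero, mul_one]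
    have : ∀ i a, w a * ((9 * p : ℝ) ^ p * Y a i ^ (2 * p)) =
      (9 * p : ℝ) ^ p * (w a * Y a i ^ (2 * p)) := fun i a => by ring
    simp only [this, ← Finset.mul_sum]
    gcongr
  · have hk' : (0 : ℝ) < k := by exact_mod_cast hk
    have h1 : ∀ i a, w a * (F i ^ 2 + 9 * p * Y a i ^ 2) ^ p ≤
        ((k : ℝ) + 1) ^ (p - 1) / (k : ℝ) ^ (p - 1) * (w a * F i ^ (2 * p)) +
        ((k : ℝ) + 1) ^ (p - 1) * (9 * p) ^ p * (w a * Y a i ^ (2 * p)) := fun i a => by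
      have := add_pow_le_succ_pow_mul p k hp hk (sq_nonneg (F i))
        (show 0 ≤ 9 * (p : ℝ) * Y a i ^ 2 by positivity)
      rw [e9, ← pow_mul] at this
      refine (mul_le_mul_of_nonneg_left this (hw a)).trans (le_of_eq ?_)
      ring
    refine (Finset.sum_le_sum fun i _ => Finset.sum_le_sum fun a _ => h1 i a).trans ?_
    simp only [Finset.sum_add_distrib, ← Finset.mul_sum, ← Finset.sum_mul, hw1, one_mul]
    calc _ ≤ ((k : ℝ) + 1) ^ (p - 1) / (k : ℝ) ^ (p - 1) * ((9 * p * k) ^ p * m) +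
        ((k : ℝ) + 1) ^ (p - 1) * (9 * p) ^ p * m := by gcongr
      _ = _ := by
        obtain ⟨q, rfl⟩ : ∃ q, p = q + 1 := ⟨p - 1, by omega⟩
        simp only [Nat.add_sub_cancel, mul_pow, pow_succ]
        field_simp

/-- Maurey's empirical method in `ℓ_{2p}`. -/
theorem exists_average_pow_le {ι A : Type*} [Fintype ι] [Fintype A] (w : A → ℝ)
    (hw : ∀ a, 0 ≤ w a) (hw1 : ∑ a, w a = 1) (g : A → ι → ℝ) (f : ι → ℝ)
    (hf : ∀ i, ∑ a, w a * g a i = f i) (p : ℕ) (hp : 1 ≤ p) {m : ℝ}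
    (hm : ∀ a, ∑ i, g a i ^ (2 * p) ≤ m) (N : ℕ) (hN : 1 ≤ N) :
    ∃ z : Fin N → A, ∑ i, (f i - (∑ k, g (z k) i) / N) ^ (2 * p) ≤ (36 * p / N) ^ p * m := by
  set Y : A → ι → ℝ := fun a i => g a i - f i with hYdef
  have hY : ∀ i, ∑ a, w a * Y a i = 0 := fun i => by
    simp only [hYdef, mul_sub, Finset.sum_sub_distrib, ← Finset.sum_mul, hw1, hf]; ring
  have hgm : ∑ a, w a * ∑ i, g a i ^ (2 * p) ≤ m := by
    calc _ ≤ ∑ a, w a * m := Finset.sum_le_sum fun a _ => mul_le_mul_of_nonneg_left (hm a) (hw a)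
      _ = m := by rw [← Finset.sum_mul, hw1, one_mul]
  have hgm' : ∑ i, ∑ a, w a * g a i ^ (2 * p) ≤ m := by
    rw [Finset.sum_comm]; simpa only [Finset.mul_sum] using hgm
  have hm' : ∑ i, ∑ a, w a * Y a i ^ (2 * p) ≤ 4 ^ p * m := by
    have h1 : ∀ i a, w a * Y a i ^ (2 * p) ≤
        4 ^ p / 2 * (w a * g a i ^ (2 * p)) + 4 ^ p / 2 * (w a * f i ^ (2 * p)) := fun i a => by
      have h2 := add_pow_two_mul_le p (g a i) (-f i)
      rw [Even.neg_pow (by simp)] at h2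
      refine (mul_le_mul_of_nonneg_left h2 (hw a)).trans (le_of_eq (by ring))
    have hfm : ∑ i, f i ^ (2 * p) ≤ m :=
      (Finset.sum_le_sum fun i _ => by
        rw [← hf i]; exact pow_sum_mul_le w (fun a => g a i) hw hw1 p).trans hgm'
    refine (Finset.sum_le_sum fun i _ => Finset.sum_le_sum fun a _ => h1 i a).trans ?_
    simp only [Finset.sum_add_distrib, ← Finset.mul_sum, ← Finset.sum_mul, hw1, one_mul]
    calc _ ≤ (4 : ℝ) ^ p / 2 * m + 4 ^ p / 2 * m := by gcongr
      _ = _ := by ring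
  have key : ∀ k : ℕ, ∃ z : Fin k → A,
      ∑ i, (∑ l, Y (z l) i) ^ (2 * p) ≤ (9 * p * k) ^ p * (4 ^ p * m) := by
    intro k
    induction k with
    | zero => exact ⟨Fin.elim0, by simp [show p ≠ 0 by omega]⟩
    | succ k ih =>
      obtain ⟨z, hz⟩ := ih
      obtain ⟨a, ha⟩ := exists_sum_add_pow_le w hw hw1 Y hY p hp hm' k _ hz
      refine ⟨Fin.snoc z a, ?_⟩
      simp only [Fin.sum_univ_castSucc, Fin.snoc_castSucc, Fin.snoc_last]
      push_cast
      exact ha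
  obtain ⟨z, hz⟩ := key N
  refine ⟨z, ?_⟩
  have hN' : (0 : ℝ) < N := by exact_mod_cast hN
  have e : ∀ i, (f i - (∑ k, g (z k) i) / N) ^ (2 * p) =
      (1 / (N : ℝ) ^ (2 * p)) * (∑ l, Y (z l) i) ^ (2 * p) := fun i => by
    have : f i - (∑ k, g (z k) i) / N = -((∑ l, Y (z l) i) / N) := by
      simp only [hYdef, Finset.sum_sub_distrib, Finset.sum_const, Finset.card_univ,
        Fintype.card_fin, nsmul_eq_mul]
      field_simp; ring
    rw [this, Even.neg_pow (by simp), div_pow]; ring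
  simp only [e, ← Finset.mul_sum]
  calc _ ≤ (1 / (N : ℝ) ^ (2 * p)) * ((9 * p * N) ^ p * (4 ^ p * m)) := by gcongr
    _ = _ := by
      rw [pow_mul, show (36 : ℝ) = 9 * 4 by norm_num]
      simp only [div_pow, mul_pow, pow_two]
      field_simp

/-- The set of `s`-sparse vectors in the Euclidean unit ball. -/
def sparseBall (K s : ℕ) : Set (Fin K → ℝ) := {x | l0 x ≤ s ∧ l2sq x ≤ 1}

/-- The sign attached to a Boolean. -/
def boolSign (b : Bool) : ℝ := if b then 1 else -1

theorem boolSign_sq (b : Bool) : boolSign b ^ 2 = 1 := by cases b <;> simp [boolSign]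

theorem l0_eq_card {n : Type*} [Fintype n] (x : n → ℝ) : l0 x = #{i | x i ≠ 0} := by
  rw [l0, Set.ncard_eq_toFinset_card']; simp

theorem l0_le_of_support {n : Type*} [Fintype n] {x y : n → ℝ} (h : ∀ i, x i = 0 → y i = 0) :
    l0 y ≤ l0 x := by
  rw [l0_eq_card, l0_eq_card]
  apply Finset.card_le_card
  intro i
  simp only [Finset.mem_filter, Finset.mem_univ, true_and]
  exact fun hy hx => hy (h i hx)

theorem l2sq_nonneg {n : Type*} [Fintype n] (x : n → ℝ) : 0 ≤ l2sq x :=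
  Finset.sum_nonneg fun _ _ => sq_nonneg _

theorem eq_zero_of_l2sq_eq_zero {n : Type*} [Fintype n] {x : n → ℝ} (h : l2sq x = 0) : x = 0 := by
  funext j
  have := (Finset.sum_eq_zero_iff_of_nonneg fun j _ => sq_nonneg (x j)).1 h j (mem_univ j)
  simpa using this

theorem zero_mem_sparseBall (K s : ℕ) : (0 : Fin K → ℝ) ∈ sparseBall K s := by
  simp [sparseBall, l0, l2sq]

theorem single_mem_sparseBall {K s : ℕ} (hs : 1 ≤ s) (j : Fin K) :
    (Pi.single j 1 : Fin K → ℝ) ∈ sparseBall K s := by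
  constructor
  · refine le_trans ?_ hs
    rw [l0_eq_card, Finset.card_le_one]
    intro a ha b hb
    simp only [Finset.mem_filter, Pi.single_apply, ne_eq, ite_eq_right_iff, one_ne_zero,
      imp_false, not_not, Finset.mem_univ, true_and] at ha hb
    rw [ha, hb]
  · simp [l2sq, Pi.single_apply]

theorem sum_abs_le_sqrt {K s : ℕ} {x : Fin K → ℝ} (hx : x ∈ sparseBall K s) :
    ∑ j, |x j| ≤ √s := by
  apply Real.le_sqrt_of_sq_le
  have e : ∑ j, |x j| = ∑ j ∈ {j | x j ≠ 0}, |x j| := by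
    rw [Finset.sum_filter_of_ne]
    intro j _ h; simpa using h
  rw [e]
  have h1 := hx.1
  rw [l0_eq_card] at h1
  calc _ ≤ (#{j | x j ≠ 0} : ℝ) * ∑ j ∈ {j | x j ≠ 0}, |x j| ^ 2 := sq_sum_le_card_mul_sum_sq
    _ ≤ (s : ℝ) * 1 := by
      gcongr
      refine le_trans ?_ hx.2
      simp only [sq_abs, l2sq]
      exact Finset.sum_le_sum_of_subset_of_nonneg (Finset.subset_univ _)
        fun _ _ _ => sq_nonneg _
    _ = s := mul_one _

theorem abs_dotProduct_le {K s : ℕ} {x : Fin K → ℝ} (hx : x ∈ sparseBall K s) {v : Fin K → ℝ}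
    {L : ℝ} (hL : 0 ≤ L) (hv : ∀ j, |v j| ≤ L) : |v ⬝ᵥ x| ≤ L * √s := by
  calc |v ⬝ᵥ x| ≤ ∑ j, |v j * x j| := Finset.abs_sum_le_sum_abs _ _
    _ ≤ ∑ j, L * |x j| := Finset.sum_le_sum fun j _ => by
      rw [abs_mul]; exact mul_le_mul_of_nonneg_right (hv j) (abs_nonneg _)
    _ ≤ _ := by rw [← Finset.mul_sum]; exact mul_le_mul_of_nonneg_left (sum_abs_le_sqrt hx) hL

theorem sq_dotProduct_le {K s : ℕ} {x : Fin K → ℝ} (hx : x ∈ sparseBall K s) {v : Fin K → ℝ}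
    {L : ℝ} (hL : 0 ≤ L) (hv : ∀ j, |v j| ≤ L) : (v ⬝ᵥ x) ^ 2 ≤ L ^ 2 * s := by
  rw [← sq_abs]
  calc |v ⬝ᵥ x| ^ 2 ≤ (L * √s) ^ 2 := by gcongr; exact abs_dotProduct_le hx hL hv
    _ = _ := by rw [mul_pow, Real.sq_sqrt (by positivity)]

theorem exists_sparse_average_pow_le {M K s : ℕ} (hs : 1 ≤ s) (hK : 1 ≤ K)
    (v : Fin M → Fin K → ℝ) {L B : ℝ} (hv : ∀ i j, |v i j| ≤ L)
    (hB : ∀ x ∈ sparseBall K s, ∑ i, (v i ⬝ᵥ x) ^ 2 ≤ B) (p : ℕ) (hp : 1 ≤ p) (N : ℕ)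
    (hN : 1 ≤ N) {x : Fin K → ℝ} (hx : x ∈ sparseBall K s) :
    ∃ z : Fin N → Fin K × Bool, ∑ i, (v i ⬝ᵥ x -
      (∑ k, √s * boolSign (z k).2 * v i (z k).1) / N) ^ (2 * p) ≤
        (36 * p * s / N) ^ p * (L ^ (2 * p - 2) * B) := by
  have hs' : (0 : ℝ) < s := by exact_mod_cast hs
  have hK' : (0 : ℝ) < K := by exact_mod_cast hK
  have hss : 0 < √(s : ℝ) := Real.sqrt_pos.2 hs'
  have hx1 := sum_abs_le_sqrt hx
  set ρ : ℝ := 1 - (∑ j, |x j|) / √s with hρ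
  have hρ0 : 0 ≤ ρ := by rw [hρ, sub_nonneg, div_le_one hss]; exact hx1
  let w : Fin K × Bool → ℝ := fun a =>
    (|x a.1| + boolSign a.2 * x a.1) / (2 * √s) + ρ / (2 * K)
  have hw : ∀ a, 0 ≤ w a := by
    rintro ⟨j, b⟩
    have : 0 ≤ |x j| + boolSign b * x j := by
      cases b
      · simp only [boolSign]; simp; linarith [le_abs_self (x j)]
      · simp only [boolSign]; simp; linarith [neg_abs_le (x j)]
    positivity
  have hw1 : ∑ a, w a = 1 := by
    rw [Fintype.sum_prod_type]
    have : ∀ j, ∑ b, w (j, b) = |x j| / √s + ρ / K := fun j => by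
      simp only [Fintype.sum_bool, w, boolSign]
      simp; field_simp; ring
    simp only [this, Finset.sum_add_distrib, ← Finset.sum_div, Finset.sum_const, Finset.card_univ,
      Fintype.card_fin, nsmul_eq_mul, hρ]
    field_simp; ring
  have hmean : ∀ i, ∑ a, w a * (√s * boolSign a.2 * v i a.1) = v i ⬝ᵥ x := fun i => by
    rw [Fintype.sum_prod_type, dotProduct]
    refine Finset.sum_congr rfl fun j _ => ?_
    simp only [Fintype.sum_bool, w, boolSign]
    simp; field_simp; ring
  have hm : ∀ a : Fin K × Bool, ∑ i, (√s * boolSign a.2 * v i a.1) ^ (2 * p) ≤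
      (s : ℝ) ^ p * (L ^ (2 * p - 2) * B) := by
    rintro ⟨j, b⟩
    have h1 : ∀ i, (√s * boolSign b * v i j) ^ (2 * p) ≤
        (s : ℝ) ^ p * (L ^ (2 * p - 2) * (v i ⬝ᵥ Pi.single j 1) ^ 2) := fun i => by
      rw [pow_mul, mul_pow, mul_pow √_, boolSign_sq, Real.sq_sqrt hs'.le, mul_one, mul_pow,
        dotProduct_single, mul_one]
      gcongr
      rw [← pow_mul, show 2 * p = (2 * p - 2) + 2 by omega, pow_add]
      simp only [Nat.add_sub_cancel]
      refine mul_le_mul_of_nonneg_right ?_ (sq_nonneg _)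
      rw [show 2 * p - 2 = 2 * (p - 1) by omega, pow_mul, pow_mul, ← sq_abs]
      gcongr
      exact hv i j
    refine (Finset.sum_le_sum fun i _ => h1 i).trans ?_
    rw [← Finset.mul_sum, ← Finset.mul_sum]
    have : 0 ≤ L ^ (2 * p - 2) := by
      rw [show 2 * p - 2 = 2 * (p - 1) by omega, pow_mul]; positivity
    gcongr
    exact hB _ (single_mem_sparseBall hs j)
  obtain ⟨z, hz⟩ := exists_average_pow_le w hw hw1 (fun a i => √s * boolSign a.2 * v i a.1)
    (fun i => v i ⬝ᵥ x) hmean p hp hm N hN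
  refine ⟨z, hz.trans (le_of_eq ?_)⟩
  rw [← mul_assoc, ← mul_pow]
  congr 2; ring

theorem sum_sq_mul_sq_le {ι : Type*} [Fintype ι] (u w : ι → ℝ) {α L B : ℝ} (hα : 0 < α)
    (hL : 0 < L) {p s : ℕ} (hs : 1 ≤ s) (hp : 1 ≤ p) (hsp : s ≤ 2 ^ (p - 1))
    (hu : ∑ i, u i ^ (2 * p) ≤ α ^ p * (L ^ (2 * p - 2) * B)) (hw : ∑ i, w i ^ 2 ≤ 4 * B)
    (hwb : ∀ i, w i ^ 2 ≤ 4 * (L ^ 2 * s)) :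
    ∑ i, u i ^ 2 * w i ^ 2 ≤ 12 * α * L ^ 2 * B := by
  have hs' : (0 : ℝ) < s := by exact_mod_cast hs
  obtain ⟨q, rfl⟩ : ∃ q, p = q + 1 := ⟨p - 1, by omega⟩
  simp only [Nat.add_sub_cancel] at hsp
  rw [show 2 * (q + 1) - 2 = 2 * q by omega] at hu
  have hsp' : (s : ℝ) ≤ 2 ^ q := by exact_mod_cast hsp
  have key : ∀ i, u i ^ 2 * w i ^ 2 ≤
      2 * α * L ^ 2 * w i ^ 2 + 4 * (α * L ^ 4 / (α ^ (q + 1) * L ^ (2 * q + 2))) *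
        u i ^ (2 * (q + 1)) := fun i => by
    have e : (α * L ^ 4 / (α ^ (q + 1) * L ^ (2 * q + 2))) * u i ^ (2 * (q + 1)) =
        u i ^ 2 * (L ^ 2 * (u i ^ 2 / (α * L ^ 2)) ^ q) := by
      rw [div_pow, mul_pow, ← pow_mul, ← pow_mul]
      simp only [pow_succ, pow_mul, mul_add]
      field_simp
    rw [mul_assoc 4, e]
    rcases le_total (u i ^ 2) (2 * α * L ^ 2) with h | h
    · have h1 := mul_le_mul_of_nonneg_right h (sq_nonneg (w i))
      have : 0 ≤ u i ^ 2 * (L ^ 2 * (u i ^ 2 / (α * L ^ 2)) ^ q) := by positivity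
      linarith
    · have h2 : 2 ≤ u i ^ 2 / (α * L ^ 2) := by
        rw [le_div_iff₀ (by positivity)]; linarith
      have h3 : (s : ℝ) ≤ (u i ^ 2 / (α * L ^ 2)) ^ q := hsp'.trans (by gcongr)
      have h4 : w i ^ 2 ≤ 4 * (L ^ 2 * (u i ^ 2 / (α * L ^ 2)) ^ q) :=
        (hwb i).trans (by gcongr)
      have h5 := mul_le_mul_of_nonneg_left h4 (sq_nonneg (u i))
      have : 0 ≤ 2 * α * L ^ 2 * w i ^ 2 := by positivity
      linarith
  refine (Finset.sum_le_sum fun i _ => key i).trans ?_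
  rw [Finset.sum_add_distrib, ← Finset.mul_sum, ← Finset.mul_sum]
  calc _ ≤ 2 * α * L ^ 2 * (4 * B) + 4 * (α * L ^ 4 / (α ^ (q + 1) * L ^ (2 * q + 2))) *
        (α ^ (q + 1) * (L ^ (2 * q) * B)) := by gcongr
    _ = _ := by
      simp only [pow_succ]
      field_simp; ring

theorem sum_sq_sub_sq_le {M K s : ℕ} (hs : 1 ≤ s) (v : Fin M → Fin K → ℝ) {L B : ℝ} (hL : 0 < L)
    (hv : ∀ i j, |v i j| ≤ L) (hB : ∀ x ∈ sparseBall K s, ∑ i, (v i ⬝ᵥ x) ^ 2 ≤ B) {p : ℕ}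
    (hp : 1 ≤ p) (hsp : s ≤ 2 ^ (p - 1)) {α : ℝ} (hα : 0 < α) (h : Fin M → ℝ) {x y : Fin K → ℝ}
    (hx : x ∈ sparseBall K s) (hy : y ∈ sparseBall K s)
    (hxh : ∑ i, (v i ⬝ᵥ x - h i) ^ (2 * p) ≤ α ^ p * (L ^ (2 * p - 2) * B))
    (hyh : ∑ i, (v i ⬝ᵥ y - h i) ^ (2 * p) ≤ α ^ p * (L ^ (2 * p - 2) * B)) :
    ∑ i, ((v i ⬝ᵥ x) ^ 2 - (v i ⬝ᵥ y) ^ 2) ^ 2 ≤ 48 * α * L ^ 2 * B := by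
  have h1 : ∑ i, (v i ⬝ᵥ x - v i ⬝ᵥ y) ^ (2 * p) ≤ (4 * α) ^ p * (L ^ (2 * p - 2) * B) := by
    have : ∀ i, (v i ⬝ᵥ x - v i ⬝ᵥ y) ^ (2 * p) ≤
        4 ^ p / 2 * (v i ⬝ᵥ x - h i) ^ (2 * p) + 4 ^ p / 2 * (v i ⬝ᵥ y - h i) ^ (2 * p) :=
      fun i => by
        have h2 := add_pow_two_mul_le p (v i ⬝ᵥ x - h i) (-(v i ⬝ᵥ y - h i))
        rw [Even.neg_pow (by simp)] at h2
        convert h2 using 1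
        · congr 1; ring
        · ring
    refine (Finset.sum_le_sum fun i _ => this i).trans ?_
    rw [Finset.sum_add_distrib, ← Finset.mul_sum, ← Finset.mul_sum, mul_pow]
    have h4 : (0 : ℝ) ≤ 4 ^ p / 2 := by positivity
    have := mul_le_mul_of_nonneg_left hxh h4
    have := mul_le_mul_of_nonneg_left hyh h4
    linarith
  have h2 := sum_sq_mul_sq_le (fun i => v i ⬝ᵥ x - v i ⬝ᵥ y) (fun i => v i ⬝ᵥ x + v i ⬝ᵥ y)
    (B := B) (by positivity : 0 < 4 * α) hL hs hp hsp h1 ?_ ?_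
  · calc _ = ∑ i, (v i ⬝ᵥ x - v i ⬝ᵥ y) ^ 2 * (v i ⬝ᵥ x + v i ⬝ᵥ y) ^ 2 :=
          Finset.sum_congr rfl fun i _ => by ring
      _ ≤ _ := h2
      _ = _ := by ring
  · have : ∀ i, (v i ⬝ᵥ x + v i ⬝ᵥ y) ^ 2 ≤ 2 * (v i ⬝ᵥ x) ^ 2 + 2 * (v i ⬝ᵥ y) ^ 2 :=
      fun i => by nlinarith [sq_nonneg (v i ⬝ᵥ x - v i ⬝ᵥ y)]
    refine (Finset.sum_le_sum fun i _ => this i).trans ?_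
    rw [Finset.sum_add_distrib, ← Finset.mul_sum, ← Finset.mul_sum]
    linarith [hB x hx, hB y hy]
  · intro i
    have a1 := sq_dotProduct_le hx hL.le (hv i)
    have a2 := sq_dotProduct_le hy hL.le (hv i)
    nlinarith [sq_nonneg (v i ⬝ᵥ x - v i ⬝ᵥ y)]

/-- At each scale there is a map of `sparseBall` into itself that factors through
`(2K) ^ N` codes and moves quadratic forms by a controlled amount. -/
theorem exists_code {M K s : ℕ} (hs : 1 ≤ s) (hK : 1 ≤ K) (v : Fin M → Fin K → ℝ) {L B : ℝ}
    (hL : 0 < L) (hv : ∀ i j, |v i j| ≤ L)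
    (hB : ∀ x ∈ sparseBall K s, ∑ i, (v i ⬝ᵥ x) ^ 2 ≤ B) {p : ℕ} (hp : 1 ≤ p)
    (hsp : s ≤ 2 ^ (p - 1)) {N : ℕ} (hN : 1 ≤ N) :
    ∃ (code : (Fin K → ℝ) → (Fin N → Fin K × Bool)) (rep : (Fin N → Fin K × Bool) → (Fin K → ℝ)),
      ∀ x ∈ sparseBall K s, rep (code x) ∈ sparseBall K s ∧
        ∑ i, ((v i ⬝ᵥ x) ^ 2 - (v i ⬝ᵥ rep (code x)) ^ 2) ^ 2 ≤
          1728 * (p / N) * (L ^ 2 * B * s) := by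
  have hex : ∀ x : Fin K → ℝ, ∃ z : Fin N → Fin K × Bool, x ∈ sparseBall K s →
      ∑ i, (v i ⬝ᵥ x - (∑ k, √s * boolSign (z k).2 * v i (z k).1) / N) ^ (2 * p) ≤
        (36 * p * s / N) ^ p * (L ^ (2 * p - 2) * B) := fun x => by
    by_cases hx : x ∈ sparseBall K s
    · obtain ⟨z, hz⟩ := exists_sparse_average_pow_le hs hK v hv hB p hp N hN hx
      exact ⟨z, fun _ => hz⟩
    · exact ⟨fun _ => (⟨0, hK⟩, true), fun h => absurd h hx⟩
  choose code hcode using hex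
  refine ⟨code, Function.invFunOn code (sparseBall K s), fun x hx => ?_⟩
  have hmem : ∃ a ∈ sparseBall K s, code a = code x := ⟨x, hx, rfl⟩
  have h1 := Function.invFunOn_mem hmem
  have h2 := Function.invFunOn_eq hmem
  refine ⟨h1, ?_⟩
  have hyh := hcode _ h1
  rw [h2] at hyh
  have hs' : (0 : ℝ) < s := by exact_mod_cast hs
  have hp' : (0 : ℝ) < p := by exact_mod_cast hp
  have hN' : (0 : ℝ) < N := by exact_mod_cast hN
  refine (sum_sq_sub_sq_le hs v hL hv hB hp hsp (by positivity) _ hx h1 (hcode x hx) hyh).trans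
    (le_of_eq ?_)
  ring

theorem sum_exp_boolSign_le {M : ℕ} (a : Fin M → ℝ) :
    ∑ ε : Fin M → Bool, Real.exp (∑ i, boolSign (ε i) * a i) ≤
      2 ^ M * Real.exp ((∑ i, a i ^ 2) / 2) := by
  simp only [Real.exp_sum]
  have h := Finset.prod_univ_sum (fun _ : Fin M => (univ : Finset Bool))
    (fun i b => Real.exp (boolSign b * a i))
  rw [Fintype.piFinset_univ] at h
  rw [← h]
  have h1 : ∀ i, ∑ b, Real.exp (boolSign b * a i) ≤ 2 * Real.exp (a i ^ 2 / 2) := fun i => by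
    have := Real.cosh_le_exp_half_sq (a i)
    rw [Real.cosh_eq] at this
    simp only [Fintype.sum_bool, boolSign]
    simp
    linarith
  refine (Finset.prod_le_prod (fun i _ => by positivity) fun i _ => h1 i).trans (le_of_eq ?_)
  rw [Finset.prod_mul_distrib, Finset.sum_div, Real.exp_sum]
  simp

theorem card_lt_sum_boolSign_le {M : ℕ} (a : Fin M → ℝ) {σ ρ τ : ℝ} (ha : ∑ i, a i ^ 2 ≤ σ)
    (hρ : 0 ≤ ρ) (h : 2 * σ * τ ≤ ρ ^ 2) :
    (#{ε : Fin M → Bool | ρ < ∑ i, boolSign (ε i) * a i} : ℝ) ≤ Real.exp (-τ) * 2 ^ M := by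
  rcases le_or_gt σ 0 with hσ | hσ
  · have h0 : ∀ i, a i = 0 := fun i => by
      have h1 := le_antisymm (ha.trans hσ) (Finset.sum_nonneg fun i _ => sq_nonneg (a i))
      have := (Finset.sum_eq_zero_iff_of_nonneg fun i _ => sq_nonneg (a i)).1 h1 i (mem_univ i)
      simpa using this
    have : ({ε : Fin M → Bool | ρ < ∑ i, boolSign (ε i) * a i} : Finset _) = ∅ := by
      simp [h0, hρ]
    rw [this]; simp; positivity
  · set S : Finset (Fin M → Bool) := {ε | ρ < ∑ i, boolSign (ε i) * a i} with hS
    have h1 : (#S : ℝ) * Real.exp (ρ / σ * ρ) ≤ 2 ^ M * Real.exp (ρ ^ 2 / (2 * σ)) := by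
      calc (#S : ℝ) * Real.exp (ρ / σ * ρ) = ∑ ε ∈ S, Real.exp (ρ / σ * ρ) := by simp
        _ ≤ ∑ ε ∈ S, Real.exp (∑ i, boolSign (ε i) * (ρ / σ * a i)) := by
          apply Finset.sum_le_sum
          intro ε hε
          have hε' : ρ < ∑ i, boolSign (ε i) * a i := by simpa [hS] using hε
          have : ∑ i, boolSign (ε i) * (ρ / σ * a i) = ρ / σ * ∑ i, boolSign (ε i) * a i := by
            rw [Finset.mul_sum]; exact Finset.sum_congr rfl fun i _ => by ring
          rw [this]
          gcongr
        _ ≤ ∑ ε : Fin M → Bool, Real.exp (∑ i, boolSign (ε i) * (ρ / σ * a i)) :=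
          Finset.sum_le_sum_of_subset_of_nonneg (Finset.subset_univ S)
            fun _ _ _ => (Real.exp_pos _).le
        _ ≤ 2 ^ M * Real.exp ((∑ i, (ρ / σ * a i) ^ 2) / 2) :=
          sum_exp_boolSign_le fun i => ρ / σ * a i
        _ ≤ _ := by
          gcongr 2 ^ M * Real.exp ?_
          simp only [mul_pow, ← Finset.mul_sum]
          calc _ ≤ (ρ / σ) ^ 2 * σ / 2 := by gcongr
            _ = _ := by field_simp
    have h2 : (#S : ℝ) = #S * Real.exp (ρ / σ * ρ) * Real.exp (-(ρ / σ * ρ)) := by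
      rw [mul_assoc, ← Real.exp_add]; simp
    rw [h2]
    calc _ ≤ 2 ^ M * Real.exp (ρ ^ 2 / (2 * σ)) * Real.exp (-(ρ / σ * ρ)) := by gcongr
      _ = Real.exp (-(ρ ^ 2 / (2 * σ))) * 2 ^ M := by
        rw [mul_assoc, ← Real.exp_add, mul_comm]; congr 2; field_simp; ring
      _ ≤ _ := by
        gcongr
        rw [le_div_iff₀ (by positivity)]; linarith

/-- Hoeffding's inequality for Rademacher sums, as a count of sign patterns. -/
theorem card_lt_abs_sum_boolSign_le {M : ℕ} (a : Fin M → ℝ) {σ ρ τ : ℝ} (ha : ∑ i, a i ^ 2 ≤ σ)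
    (hρ : 0 ≤ ρ) (h : 2 * σ * τ ≤ ρ ^ 2) :
    (#{ε : Fin M → Bool | ρ < |∑ i, boolSign (ε i) * a i|} : ℝ) ≤ 2 * Real.exp (-τ) * 2 ^ M := by
  have h1 := card_lt_sum_boolSign_le a ha hρ h
  have h2 := card_lt_sum_boolSign_le (fun i => -a i) (by simpa using ha) hρ h
  have hsub : ({ε : Fin M → Bool | ρ < |∑ i, boolSign (ε i) * a i|} : Finset _) ⊆
      ({ε : Fin M → Bool | ρ < ∑ i, boolSign (ε i) * a i} : Finset _) ∪
        ({ε : Fin M → Bool | ρ < ∑ i, boolSign (ε i) * -a i} : Finset _) := by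
    intro ε
    simp only [Finset.mem_filter, Finset.mem_univ, true_and, Finset.mem_union, mul_neg,
      Finset.sum_neg_distrib]
    exact lt_abs.1
  have h3 := (Finset.card_le_card hsub).trans (Finset.card_union_le _ _)
  have h4 : (#{ε : Fin M → Bool | ρ < |∑ i, boolSign (ε i) * a i|} : ℝ) ≤
      #{ε : Fin M → Bool | ρ < ∑ i, boolSign (ε i) * a i} +
        #{ε : Fin M → Bool | ρ < ∑ i, boolSign (ε i) * -a i} := by exact_mod_cast h3
  linarith

open Classical in
/-- A finite chaining bound for Rademacher processes. -/
theorem card_chaining_le {X : Type*} {M : ℕ} (T : Finset X) (f : ℕ → X → Fin M → ℝ) (J : ℕ)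
    (hf : ∀ x, f 0 x = 0) (σ c ρ : ℕ → ℝ) (t : ℝ)
    (hcard : ∀ k < J, (#(T.image fun x => f (k + 1) x - f k x) : ℝ) ≤ Real.exp (c k))
    (hσ : ∀ k < J, ∀ x ∈ T, ∑ i, (f (k + 1) x i - f k x i) ^ 2 ≤ σ k) (hρ : ∀ k < J, 0 ≤ ρ k)
    (h : ∀ k < J, 2 * σ k * (c k + t) ≤ ρ k ^ 2) :
    (#{ε : Fin M → Bool | ∃ x ∈ T, ∑ k ∈ range J, ρ k < |∑ i, boolSign (ε i) * f J x i|} : ℝ) ≤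
      J * (2 * Real.exp (-t) * 2 ^ M) := by
  let bad : ℕ → (Fin M → ℝ) → Finset (Fin M → Bool) := fun k a =>
    {ε | ρ k < |∑ i, boolSign (ε i) * a i|}
  have hsub : ({ε : Fin M → Bool | ∃ x ∈ T, ∑ k ∈ range J, ρ k <
      |∑ i, boolSign (ε i) * f J x i|} : Finset _) ⊆
      (range J).biUnion fun k => (T.image fun x => f (k + 1) x - f k x).biUnion (bad k) := by
    intro ε hε
    simp only [Finset.mem_filter, Finset.mem_univ, true_and] at hε
    obtain ⟨x, hx, hlt⟩ := hε
    by_contra hcon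
    simp only [Finset.mem_biUnion, Finset.mem_range, Finset.mem_image, bad, Finset.mem_filter,
      Finset.mem_univ, true_and, not_exists, not_and, not_lt] at hcon
    have e : ∑ i, boolSign (ε i) * f J x i =
        ∑ k ∈ range J, ∑ i, boolSign (ε i) * (f (k + 1) x - f k x) i := by
      have := Finset.sum_range_sub (fun k => ∑ i, boolSign (ε i) * f k x i) J
      simp only [hf, Pi.zero_apply, mul_zero, Finset.sum_const_zero, sub_zero] at this
      rw [← this]
      refine Finset.sum_congr rfl fun k _ => ?_
      rw [← Finset.sum_sub_distrib]
      exact Finset.sum_congr rfl fun i _ => by rw [Pi.sub_apply]; ring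
    rw [e] at hlt
    refine absurd hlt (not_lt.2 ((Finset.abs_sum_le_sum_abs _ _).trans ?_))
    exact Finset.sum_le_sum fun k hk => hcon k (Finset.mem_range.1 hk) _ ⟨x, hx, rfl⟩
  have h1 := (Finset.card_le_card hsub).trans Finset.card_biUnion_le
  have h2 : ∀ k ∈ range J,
      (#((T.image fun x => f (k + 1) x - f k x).biUnion (bad k)) : ℝ) ≤
        2 * Real.exp (-t) * 2 ^ M := by
    intro k hk
    have hk := Finset.mem_range.1 hk
    calc (#((T.image fun x => f (k + 1) x - f k x).biUnion (bad k)) : ℝ)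
        ≤ ∑ a ∈ T.image fun x => f (k + 1) x - f k x, (#(bad k a) : ℝ) := by
          exact_mod_cast Finset.card_biUnion_le
      _ ≤ ∑ a ∈ T.image fun x => f (k + 1) x - f k x, 2 * Real.exp (-(c k + t)) * 2 ^ M := by
          apply Finset.sum_le_sum
          intro a ha
          obtain ⟨x, hx, rfl⟩ := Finset.mem_image.1 ha
          exact card_lt_abs_sum_boolSign_le _ (hσ k hk x hx) (hρ k hk) (h k hk)
      _ = #(T.image fun x => f (k + 1) x - f k x) * (2 * Real.exp (-(c k + t)) * 2 ^ M) := by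
          simp
      _ ≤ Real.exp (c k) * (2 * Real.exp (-(c k + t)) * 2 ^ M) := by
          gcongr; exact hcard k hk
      _ = _ := by
          rw [neg_add, Real.exp_add, Real.exp_neg (c k)]; field_simp
  calc _ ≤ ∑ k ∈ range J, (#((T.image fun x => f (k + 1) x - f k x).biUnion (bad k)) : ℝ) := by
        exact_mod_cast h1
    _ ≤ ∑ k ∈ range J, 2 * Real.exp (-t) * 2 ^ M := Finset.sum_le_sum h2
    _ = _ := by simp

theorem exists_int_div_near (m : ℕ) (hm : 1 ≤ m) {x : ℝ} (hx : |x| ≤ 1) :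
    ∃ k ∈ Finset.Icc (-(m : ℤ)) m, |x - k / m| ≤ 1 / m ∧ |(k / m : ℝ)| ≤ |x| := by
  have hm' : (0 : ℝ) < m := by exact_mod_cast hm
  have key : ∀ y : ℝ, 0 ≤ y → y ≤ 1 → ∃ k : ℤ, 0 ≤ k ∧ k ≤ m ∧ |y - k / m| ≤ 1 / m ∧
      |(k / m : ℝ)| ≤ y := fun y hy hy1 => by
    have h1 := Int.floor_le (m * y)
    have h2 := Int.lt_floor_add_one (m * y)
    have h0 : 0 ≤ ⌊m * y⌋ := Int.floor_nonneg.2 (by positivity)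
    have h0' : (0 : ℝ) ≤ ⌊m * y⌋ := by exact_mod_cast h0
    have h3 : (⌊m * y⌋ : ℝ) / m ≤ y := by rw [div_le_iff₀ hm']; linarith
    refine ⟨⌊m * y⌋, h0, ?_, ?_, ?_⟩
    · have : (⌊m * y⌋ : ℝ) ≤ m := h1.trans (by nlinarith)
      exact_mod_cast this
    · rw [abs_of_nonneg (by linarith), sub_le_iff_le_add, ← add_div, le_div_iff₀ hm']; linarith
    · rwa [abs_of_nonneg (by positivity)]
  rcases le_total 0 x with h | h
  · obtain ⟨k, h1, h2, h3, h4⟩ := key x h (by rwa [abs_of_nonneg h] at hx)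
    exact ⟨k, Finset.mem_Icc.2 ⟨by omega, h2⟩, h3, by rwa [abs_of_nonneg h]⟩
  · obtain ⟨k, h1, h2, h3, h4⟩ := key (-x) (by linarith) (by rwa [abs_of_nonpos h] at hx)
    refine ⟨-k, Finset.mem_Icc.2 ⟨by omega, by omega⟩, ?_, ?_⟩
    · rw [← abs_neg]; push_cast; convert h3 using 2; ring
    · rw [abs_of_nonpos h, ← abs_neg]; push_cast; convert h4 using 2; ring

theorem exists_fin_map_covering {K s : ℕ} (hK : 1 ≤ K) (S : Finset (Fin K)) (hS : #S ≤ s) :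
    ∃ f : Fin s → Fin K, ∀ j ∈ S, ∃ k, f k = j := by
  refine ⟨fun k => if h : k.1 < #S then (S.equivFin.symm ⟨k, h⟩).1 else ⟨0, hK⟩, fun j hj => ?_⟩
  refine ⟨⟨S.equivFin ⟨j, hj⟩, lt_of_lt_of_le (Fin.is_lt _) hS⟩, ?_⟩
  simp

open Classical in
/-- A finite net of the sparse unit ball. -/
theorem exists_sparse_net {K s : ℕ} (hs : 1 ≤ s) (hsK : s ≤ K) (hK : 2 ≤ K) :
    ∃ T : Finset (Fin K → ℝ), (#T : ℝ) ≤ Real.exp (7 * s * Real.log K) ∧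
      (∀ y ∈ T, y ∈ sparseBall K s) ∧
      ∀ x ∈ sparseBall K s, ∃ y ∈ T, (∀ j, x j = 0 → y j = 0) ∧ l2sq (x - y) ≤ 1 / 64 := by
  set m : ℕ := 8 * s with hm
  have hs' : (0 : ℝ) < s := by exact_mod_cast hs
  have hmpos : (0 : ℝ) < m := by rw [hm]; push_cast; positivity
  let grid : Finset ℝ := (Finset.Icc (-(m : ℤ)) m).image fun k : ℤ => (k / m : ℝ)
  let Φ : (Fin s → Fin K) × (Fin s → ℝ) → Fin K → ℝ := fun fg j =>
    if h : ∃ k, fg.1 k = j then fg.2 h.choose else 0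
  let T₀ : Finset (Fin K → ℝ) := (univ ×ˢ Fintype.piFinset fun _ : Fin s => grid).image Φ
  refine ⟨T₀.filter (· ∈ sparseBall K s), ?_, fun y hy => (Finset.mem_filter.1 hy).2, ?_⟩
  · have h1 : #(T₀.filter (· ∈ sparseBall K s)) ≤ (K ^ 7) ^ s := by
      calc #(T₀.filter (· ∈ sparseBall K s)) ≤ #T₀ := Finset.card_filter_le _ _
        _ ≤ #(univ ×ˢ Fintype.piFinset fun _ : Fin s => grid) := Finset.card_image_le
        _ = K ^ s * #grid ^ s := by simp [Finset.card_product]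
        _ ≤ K ^ s * (17 * K) ^ s := by
          gcongr
          refine Finset.card_image_le.trans ?_
          rw [Int.card_Icc]; omega
        _ = (17 * K ^ 2) ^ s := by rw [← mul_pow]; ring
        _ ≤ _ := by
          gcongr
          calc 17 * K ^ 2 ≤ K ^ 5 * K ^ 2 := by
                gcongr
                calc 17 ≤ 2 ^ 5 := by norm_num
                  _ ≤ K ^ 5 := by gcongr
            _ = K ^ 7 := by ring
    calc _ ≤ (((K ^ 7) ^ s : ℕ) : ℝ) := by exact_mod_cast h1
      _ = _ := by
        have : Real.exp (7 * s * Real.log K) = Real.exp (Real.log K) ^ (7 * s) := by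
          rw [← Real.exp_nat_mul]; push_cast; ring_nf
        rw [this, Real.exp_log (by positivity), pow_mul]; push_cast; rfl
  · intro x hx
    have hx1 : ∀ j, |x j| ≤ 1 := fun j => by
      rw [← sq_le_one_iff_abs_le_one]
      exact (Finset.single_le_sum (f := fun j => x j ^ 2) (fun _ _ => sq_nonneg _)
        (mem_univ j)).trans hx.2
    choose k hk1 hk2 hk3 using fun j => exists_int_div_near m (by omega) (hx1 j)
    set y : Fin K → ℝ := fun j => k j / m with hy
    have hy0 : ∀ j, x j = 0 → y j = 0 := fun j h => by
      have := hk3 j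
      rw [h, abs_zero] at this
      exact abs_nonpos_iff.1 this
    have hyT : y ∈ sparseBall K s :=
      ⟨(l0_le_of_support hy0).trans hx.1,
        le_trans (Finset.sum_le_sum fun j _ => sq_le_sq.2 (hk3 j)) hx.2⟩
    refine ⟨y, Finset.mem_filter.2 ⟨?_, hyT⟩, hy0, ?_⟩
    · obtain ⟨f, hf⟩ := exists_fin_map_covering (s := s) (by omega : 1 ≤ K) {j | y j ≠ 0}
        (by rw [← l0_eq_card]; exact hyT.1)
      refine Finset.mem_image.2 ⟨(f, fun l => y (f l)), ?_, ?_⟩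
      · refine Finset.mem_product.2 ⟨mem_univ _, Fintype.mem_piFinset.2 fun l => ?_⟩
        exact Finset.mem_image.2 ⟨k (f l), hk1 _, rfl⟩
      · funext j
        by_cases h : ∃ l, f l = j
        · simp only [Φ, dif_pos h]; rw [h.choose_spec]
        · simp only [Φ, dif_neg h]
          by_contra hne
          exact h (hf j (by simpa using Ne.symm hne))
    · have e : l2sq (x - y) ≤ ∑ j ∈ {j | x j ≠ 0}, (1 / (m : ℝ)) ^ 2 := by
        rw [l2sq, ← Finset.sum_filter_add_sum_filter_not univ (fun j => x j ≠ 0)]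
        have : ∑ j ∈ {j | ¬ x j ≠ 0}, (x - y) j ^ 2 = 0 := by
          apply Finset.sum_eq_zero
          intro j hj
          have hj : x j = 0 := by simpa using hj
          simp [hj, hy0 j hj]
        rw [this, add_zero]
        apply Finset.sum_le_sum
        intro j _
        rw [← sq_abs]
        exact pow_le_pow_left₀ (abs_nonneg _) (hk2 j) 2
      refine e.trans ?_
      have h1 := hx.1
      rw [l0_eq_card] at h1
      rw [Finset.sum_const, nsmul_eq_mul]
      have hs1 : (1 : ℝ) ≤ s := by exact_mod_cast hs
      calc _ ≤ (s : ℝ) * (1 / (m : ℝ)) ^ 2 := by gcongr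
        _ ≤ _ := by
          rw [hm]; push_cast
          rw [div_pow, ← mul_div_assoc, div_le_div_iff₀ (by positivity) (by positivity)]
          nlinarith

theorem abs_quad_le_mul_l2sq {M K s : ℕ} (e : Fin M → ℝ) (v : Fin M → Fin K → ℝ) {W : ℝ}
    (hW : ∀ x ∈ sparseBall K s, |∑ i, e i * (v i ⬝ᵥ x) ^ 2| ≤ W) {x : Fin K → ℝ}
    (hx : l0 x ≤ s) : |∑ i, e i * (v i ⬝ᵥ x) ^ 2| ≤ W * l2sq x := by
  rcases (l2sq_nonneg x).eq_or_lt with h | h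
  · simp [eq_zero_of_l2sq_eq_zero h.symm, l2sq]
  · have hr : 0 < √(l2sq x) := Real.sqrt_pos.2 h
    have hy : (√(l2sq x))⁻¹ • x ∈ sparseBall K s := by
      refine ⟨(l0_le_of_support fun j hj => by simp [hj]).trans hx, le_of_eq ?_⟩
      simp only [l2sq, Pi.smul_apply, smul_eq_mul, mul_pow, ← Finset.mul_sum]
      change (√(l2sq x))⁻¹ ^ 2 * l2sq x = 1
      rw [inv_pow, Real.sq_sqrt h.le]; field_simp
    have h1 := hW _ hy
    have h2 : ∑ i, e i * (v i ⬝ᵥ ((√(l2sq x))⁻¹ • x)) ^ 2 =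
        (l2sq x)⁻¹ * ∑ i, e i * (v i ⬝ᵥ x) ^ 2 := by
      rw [Finset.mul_sum]
      refine Finset.sum_congr rfl fun i _ => ?_
      rw [dotProduct_smul, smul_eq_mul, mul_pow, inv_pow, Real.sq_sqrt h.le]; ring
    rw [h2, abs_mul, abs_of_pos (inv_pos.2 h), inv_mul_le_iff₀ h] at h1
    linarith

theorem l2sq_smul_add_smul {n : Type*} [Fintype n] (a b : ℝ) (u w : n → ℝ) :
    l2sq (a • u + b • w) + l2sq (a • u - b • w) = 2 * (a ^ 2 * l2sq u + b ^ 2 * l2sq w) := by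
  simp only [l2sq, Finset.mul_sum, ← Finset.sum_add_distrib]
  exact Finset.sum_congr rfl fun i _ => by simp; ring

theorem abs_quad_le_of_net {M K s : ℕ} (e : Fin M → ℝ) (v : Fin M → Fin K → ℝ) {L : ℝ}
    (hL : 0 ≤ L) (hv : ∀ i j, |v i j| ≤ L) (T : Finset (Fin K → ℝ))
    (hT : ∀ y ∈ T, y ∈ sparseBall K s)
    (hnet : ∀ x ∈ sparseBall K s, ∃ y ∈ T, (∀ j, x j = 0 → y j = 0) ∧ l2sq (x - y) ≤ 1 / 64)
    {w : ℝ} (hw : ∀ y ∈ T, |∑ i, e i * (v i ⬝ᵥ y) ^ 2| ≤ w) {x : Fin K → ℝ}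
    (hx : x ∈ sparseBall K s) : |∑ i, e i * (v i ⬝ᵥ x) ^ 2| ≤ 2 * w := by
  set q : (Fin K → ℝ) → ℝ := fun x => ∑ i, e i * (v i ⬝ᵥ x) ^ 2 with hq
  set W : ℝ := sSup ((fun x => |q x|) '' sparseBall K s) with hWdef
  have hbdd : BddAbove ((fun x => |q x|) '' sparseBall K s) := by
    refine ⟨∑ i, |e i| * (L ^ 2 * s), ?_⟩
    rintro _ ⟨y, hy, rfl⟩
    refine (Finset.abs_sum_le_sum_abs _ _).trans (Finset.sum_le_sum fun i _ => ?_)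
    rw [abs_mul, abs_of_nonneg (sq_nonneg (v i ⬝ᵥ y))]
    gcongr
    exact sq_dotProduct_le hy hL (hv i)
  have hW : ∀ y ∈ sparseBall K s, |q y| ≤ W := fun y hy => le_csSup hbdd ⟨y, hy, rfl⟩
  have hW0 : 0 ≤ W := (abs_nonneg _).trans (hW 0 (zero_mem_sparseBall K s))
  have key : ∀ y ∈ sparseBall K s, |q y| ≤ w + W / 4 := by
    intro y hy
    obtain ⟨y', hy'T, hsupp, hdist⟩ := hnet y hy
    set u := y - y'
    set z := y + y'
    have hz : l2sq z ≤ 4 := by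
      have h1 := hy.2
      have h2 := (hT _ hy'T).2
      have h3 := l2sq_smul_add_smul 1 1 y y'
      have h4 := l2sq_nonneg (y - y')
      simp only [one_smul] at h3
      linarith
    have e1 : q y - q y' = (q ((4 : ℝ) • u + (1 / 4 : ℝ) • z) -
        q ((4 : ℝ) • u - (1 / 4 : ℝ) • z)) / 4 := by
      simp only [hq, ← Finset.sum_sub_distrib, Finset.sum_div]
      refine Finset.sum_congr rfl fun i _ => ?_
      simp only [u, z, dotProduct_add, dotProduct_sub, dotProduct_smul, smul_eq_mul]
      ring
    have hs1 : l0 ((4 : ℝ) • u + (1 / 4 : ℝ) • z) ≤ s :=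
      (l0_le_of_support fun j hj => by simp [u, z, hj, hsupp j hj]).trans hy.1
    have hs2 : l0 ((4 : ℝ) • u - (1 / 4 : ℝ) • z) ≤ s :=
      (l0_le_of_support fun j hj => by simp [u, z, hj, hsupp j hj]).trans hy.1
    have b1 := abs_quad_le_mul_l2sq e v hW hs1
    have b2 := abs_quad_le_mul_l2sq e v hW hs2
    have b3 := l2sq_smul_add_smul 4 (1 / 4) u z
    have b4 : l2sq ((4 : ℝ) • u + (1 / 4 : ℝ) • z) + l2sq ((4 : ℝ) • u - (1 / 4 : ℝ) • z) ≤ 1 := by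
      rw [b3]; linarith
    have b5 : |q y - q y'| ≤ W / 4 := by
      rw [e1, abs_div, abs_of_pos (by norm_num : (0 : ℝ) < 4)]
      have := abs_sub (q ((4 : ℝ) • u + (1 / 4 : ℝ) • z)) (q ((4 : ℝ) • u - (1 / 4 : ℝ) • z))
      have b6 := mul_le_mul_of_nonneg_left b4 hW0
      have : |q ((4 : ℝ) • u + (1 / 4 : ℝ) • z) - q ((4 : ℝ) • u - (1 / 4 : ℝ) • z)| ≤ W := by
        simp only [hq] at this ⊢
        linarith
      linarith
    have b7 := hw _ hy'T
    have b8 := abs_add_le (q y - q y') (q y')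
    rw [sub_add_cancel] at b8
    simp only [hq] at b8 b5 ⊢
    linarith
  have hWle : W ≤ w + W / 4 := by
    refine csSup_le (Set.Nonempty.image _ ⟨0, zero_mem_sparseBall K s⟩) ?_
    rintro _ ⟨y, hy, rfl⟩
    exact key y hy
  have := hW x hx
  simp only [hq] at this
  linarith

theorem card_image_comp_le {X Y Z : Type*} [DecidableEq Y] [Fintype Z] (T : Finset X)
    (code : X → Z) (g : Z → Y) :
    #(T.image fun x => g (code x)) ≤ Fintype.card Z := by
  have : (T.image fun x => g (code x)) ⊆ (univ : Finset Z).image g := by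
    intro y hy
    obtain ⟨x, -, rfl⟩ := Finset.mem_image.1 hy
    exact Finset.mem_image_of_mem _ (mem_univ _)
  exact (Finset.card_le_card this).trans Finset.card_image_le

theorem card_codes_le_exp {K : ℕ} (hK : 2 ≤ K) (N : ℕ) :
    (Fintype.card (Fin N → Fin K × Bool) : ℝ) ≤ Real.exp (2 * N * Real.log K) := by
  have hK0 : (0 : ℝ) < K := by positivity
  have h1 : Real.exp (2 * N * Real.log K) = ((K : ℝ) ^ 2) ^ N := by
    rw [show 2 * N * Real.log K = ((2 * N : ℕ) : ℝ) * Real.log K by push_cast; ring,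
      Real.exp_nat_mul, Real.exp_log hK0, pow_mul]
  rw [h1]
  simp only [Fintype.card_pi, Fintype.card_prod, Fintype.card_fin, Fintype.card_bool, prod_const,
    card_univ]
  push_cast
  gcongr
  have : (2 : ℝ) ≤ K := by exact_mod_cast hK
  nlinarith

theorem sum_range_three_quarters_le (J : ℕ) : ∑ k ∈ range J, (3 / 4 : ℝ) ^ k ≤ 4 := by
  have := geom_sum_eq (show (3 / 4 : ℝ) ≠ 1 by norm_num) J
  rw [this]
  have : (0 : ℝ) ≤ (3 / 4) ^ J := by positivity
  norm_num
  linarith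

open Classical in
/-- Uniform concentration of Rademacher sums of squared linear forms over sparse vectors. -/
theorem card_exists_lt_abs_sum_boolSign_le {M K s n : ℕ} (hs : 1 ≤ s) (hsK : s ≤ K) (hK : 2 ≤ K)
    (hn : 1 ≤ n) (hsn : s ≤ 2 ^ n) (v : Fin M → Fin K → ℝ) {L B : ℝ} (hL : 0 < L)
    (hv : ∀ i j, |v i j| ≤ L) (hB : ∀ x ∈ sparseBall K s, ∑ i, (v i ⬝ᵥ x) ^ 2 ≤ B) :
    (#{ε : Fin M → Bool | ∃ x ∈ sparseBall K s,
        8064 * n * √(L ^ 2 * B * s * n * Real.log K) <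
          |∑ i, boolSign (ε i) * (v i ⬝ᵥ x) ^ 2|} : ℝ) ≤
      (n + 2) * (2 * Real.exp (-(16 * n ^ 3 * Real.log K)) * 2 ^ M) := by
  classical
  set ℓ := Real.log K with hℓ
  have hℓ0 : 0 < ℓ := Real.log_pos (by exact_mod_cast hK)
  have hn' : (1 : ℝ) ≤ n := by exact_mod_cast hn
  have hB0 : 0 ≤ B := by simpa using hB 0 (zero_mem_sparseBall K s)
  set Λ := L ^ 2 * B * s with hΛ
  have hΛ0 : 0 ≤ Λ := by positivity
  set R := √(Λ * n * ℓ) with hR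
  have hR0 : 0 ≤ R := Real.sqrt_nonneg _
  have hR2 : R ^ 2 = Λ * n * ℓ := Real.sq_sqrt (by positivity)
  obtain ⟨T, hTcard, hT, hnet⟩ := exists_sparse_net hs hsK hK
  have hcode := fun k : ℕ => exists_code hs (by omega : 1 ≤ K) v hL hv hB (p := n + 1) (by omega)
    (by simpa using hsn) (N := (n + 1) * 2 ^ k) (Nat.mul_pos (by omega) (by positivity))
  choose code rep hrep using hcode
  let y : ℕ → (Fin K → ℝ) → (Fin K → ℝ) := fun k x =>
    if k < n + 1 then rep k (code k x) else x
  let f : ℕ → (Fin K → ℝ) → Fin M → ℝ := fun k x =>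
    match k with
    | 0 => 0
    | k + 1 => fun i => (v i ⬝ᵥ y k x) ^ 2
  have hdist : ∀ k, ∀ x ∈ sparseBall K s,
      ∑ i, ((v i ⬝ᵥ x) ^ 2 - (v i ⬝ᵥ y k x) ^ 2) ^ 2 ≤ 1728 * Λ / 2 ^ k := by
    intro k x hx
    by_cases hk : k < n + 1
    · simp only [y, hk, if_true]
      refine ((hrep k x hx).2).trans (le_of_eq ?_)
      rw [← hΛ]
      push_cast
      field_simp
    · simp only [y, hk, if_false, sub_self]
      simp; positivity
  have hy : ∀ k, ∀ x ∈ sparseBall K s, y k x ∈ sparseBall K s := by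
    intro k x hx
    simp only [y]
    split_ifs
    exacts [(hrep k x hx).1, hx]
  have hmain := card_chaining_le T f (n + 2) (fun _ => rfl) (fun k => 10368 * Λ / 2 ^ k)
    (fun k => 16 * n * ℓ * 2 ^ k) (fun k => 576 * R * (1 + n * (3 / 4) ^ k)) (16 * n ^ 3 * ℓ)
    ?_ ?_ ?_ ?_
  · push_cast at hmain
    refine le_trans ?_ hmain
    refine Nat.cast_le.2 (Finset.card_le_card fun ε hε => ?_)
    simp only [Finset.mem_filter, mem_univ, true_and] at hε ⊢
    obtain ⟨x, hx, hlt⟩ := hε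
    by_contra hcon
    push Not at hcon
    refine absurd (abs_quad_le_of_net (fun i => boolSign (ε i)) v hL.le hv T hT hnet
      (w := 4032 * n * R) (fun z hz => ?_) hx) (by linarith)
    have h1 := hcon z hz
    have h2 : f (n + 2) z = fun i => (v i ⬝ᵥ z) ^ 2 := by
      simp [f, y]
    rw [h2] at h1
    refine h1.trans ?_
    rw [← Finset.mul_sum, Finset.sum_add_distrib, ← Finset.mul_sum]
    have h3 := sum_range_three_quarters_le (n + 2)
    simp only [sum_const, card_range, nsmul_eq_mul, mul_one]
    push_cast
    have h4 : (n : ℝ) + 2 + n * ∑ k ∈ range (n + 2), (3 / 4 : ℝ) ^ k ≤ 7 * n := by nlinarith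
    nlinarith [mul_le_mul_of_nonneg_left h4 hR0]
  · intro k hk
    rcases k with _ | k
    · have h1 := card_image_comp_le T (code 0)
        (fun z => (fun i => (v i ⬝ᵥ rep 0 z) ^ 2 : Fin M → ℝ))
      have h2 : (T.image fun x => f (0 + 1) x - f 0 x) =
          T.image fun x => (fun i => (v i ⬝ᵥ rep 0 (code 0 x)) ^ 2 : Fin M → ℝ) := by
        refine Finset.image_congr fun x _ => ?_
        simp [f, y]
      rw [h2]
      refine (Nat.cast_le.2 h1).trans ((card_codes_le_exp hK _).trans (Real.exp_le_exp.2 ?_))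
      push_cast
      rw [pow_zero, mul_one]
      nlinarith
    · rcases Nat.lt_or_ge k n with hkn | hkn
      · have h1 := card_image_comp_le T (fun x => (code (k + 1) x, code k x))
          (fun z => (fun i => (v i ⬝ᵥ rep (k + 1) z.1) ^ 2 - (v i ⬝ᵥ rep k z.2) ^ 2 : Fin M → ℝ))
        have h2 : (T.image fun x => f (k + 1 + 1) x - f (k + 1) x) =
            T.image fun x => (fun i => (v i ⬝ᵥ rep (k + 1) (code (k + 1) x)) ^ 2 -
              (v i ⬝ᵥ rep k (code k x)) ^ 2 : Fin M → ℝ) := by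
          refine Finset.image_congr fun x _ => ?_
          funext i
          simp [f, y, show k < n from hkn, show k ≤ n by omega]
        rw [h2]
        refine (Nat.cast_le.2 h1).trans ?_
        rw [Fintype.card_prod, Nat.cast_mul]
        refine (mul_le_mul (card_codes_le_exp hK _) (card_codes_le_exp hK _) (by positivity)
          (by positivity)).trans ?_
        rw [← Real.exp_add]
        refine Real.exp_le_exp.2 ?_
        push_cast
        rw [pow_succ]
        have : (0 : ℝ) < 2 ^ k * ℓ := by positivity
        nlinarith
      · have hk' : k = n := by omega
        subst hk'
        refine (Nat.cast_le.2 Finset.card_image_le).trans (hTcard.trans (Real.exp_le_exp.2 ?_))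
        have h3 : (s : ℝ) ≤ 2 ^ k := by exact_mod_cast hsn
        rw [pow_succ]
        have h4 : (s : ℝ) * ℓ ≤ 2 ^ k * ℓ := by gcongr
        have : (0 : ℝ) < 2 ^ k * ℓ := by positivity
        nlinarith
  · intro k hk x hx
    have hx' := hT x hx
    rcases k with _ | k
    · have h0 : ∀ i, f (0 + 1) x i - f 0 x i = (v i ⬝ᵥ y 0 x) ^ 2 := fun i => by simp [f]
      simp only [h0]
      have h1 : ∑ i, ((v i ⬝ᵥ y 0 x) ^ 2) ^ 2 ≤ ∑ i, L ^ 2 * s * (v i ⬝ᵥ y 0 x) ^ 2 := by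
        refine Finset.sum_le_sum fun i _ => ?_
        rw [sq ((v i ⬝ᵥ y 0 x) ^ 2)]
        exact mul_le_mul_of_nonneg_right (sq_dotProduct_le (hy 0 x hx') hL.le (hv i))
          (sq_nonneg _)
      rw [← Finset.mul_sum] at h1
      refine h1.trans ?_
      have h2 := mul_le_mul_of_nonneg_left (hB _ (hy 0 x hx'))
        (show 0 ≤ L ^ 2 * (s : ℝ) by positivity)
      refine h2.trans ?_
      rw [show L ^ 2 * (s : ℝ) * B = Λ by rw [hΛ]; ring]
      simp; linarith
    · have h0 : ∀ i, (f (k + 1 + 1) x i - f (k + 1) x i) ^ 2 ≤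
          2 * ((v i ⬝ᵥ x) ^ 2 - (v i ⬝ᵥ y (k + 1) x) ^ 2) ^ 2 +
            2 * ((v i ⬝ᵥ x) ^ 2 - (v i ⬝ᵥ y k x) ^ 2) ^ 2 := fun i => by
        simp only [f]
        nlinarith [sq_nonneg (((v i ⬝ᵥ x) ^ 2 - (v i ⬝ᵥ y (k + 1) x) ^ 2) +
          ((v i ⬝ᵥ x) ^ 2 - (v i ⬝ᵥ y k x) ^ 2))]
      refine (Finset.sum_le_sum fun i _ => h0 i).trans ?_
      rw [Finset.sum_add_distrib, ← Finset.mul_sum, ← Finset.mul_sum]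
      have h1 := hdist (k + 1) x hx'
      have h2 := hdist k x hx'
      have h3 : 1728 * Λ / 2 ^ k = 2 * (1728 * Λ / 2 ^ (k + 1)) := by rw [pow_succ]; field_simp
      have h4 : 10368 * Λ / 2 ^ (k + 1) = 6 * (1728 * Λ / 2 ^ (k + 1)) := by ring
      simp only [h4]
      linarith
  · intro k _
    positivity
  · intro k _
    have h1 : (1 / 2 : ℝ) ^ k ≤ (9 / 16) ^ k :=
      pow_le_pow_left₀ (by norm_num) (by norm_num) k
    have h2 : ((3 / 4 : ℝ) ^ k) ^ 2 = (9 / 16) ^ k := by rw [← pow_mul, mul_comm, pow_mul]; norm_num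
    have h3 : 2 * (10368 * Λ / 2 ^ k) * (16 * n * ℓ * 2 ^ k + 16 * n ^ 3 * ℓ) =
        331776 * (Λ * n * ℓ) * (1 + n ^ 2 * (1 / 2) ^ k) := by
      rw [one_div, inv_pow]; field_simp; ring
    have h4 : (576 * R * (1 + n * (3 / 4) ^ k)) ^ 2 =
        331776 * (Λ * n * ℓ) * (1 + 2 * (n * (3 / 4) ^ k) + n ^ 2 * (9 / 16) ^ k) := by
      rw [← h2, ← hR2]; ring
    rw [h3, h4]
    gcongr
    have : (0 : ℝ) ≤ 2 * (n * (3 / 4) ^ k) := by positivity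
    linarith

theorem bddAbove_range_sparseBall {K s : ℕ} {q : (Fin K → ℝ) → ℝ} (hq : Continuous q) :
    BddAbove (Set.range fun x : sparseBall K s => q x) := by
  have h1 : sparseBall K s ⊆ Metric.closedBall 0 1 := by
    intro x hx
    rw [mem_closedBall_zero_iff, pi_norm_le_iff_of_nonneg zero_le_one]
    intro j
    rw [Real.norm_eq_abs, ← sq_le_one_iff_abs_le_one]
    exact (Finset.single_le_sum (fun i _ => sq_nonneg (x i)) (mem_univ j)).trans hx.2
  have h2 := ((isCompact_closedBall (0 : Fin K → ℝ) 1).image hq).bddAbove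
  refine h2.mono ?_
  rintro _ ⟨x, rfl⟩
  exact Set.mem_image_of_mem q (h1 x.2)

theorem measurable_iSup_sparseBall {K s : ℕ} {α : Type*} [TopologicalSpace α] [MeasurableSpace α]
    [OpensMeasurableSpace α] {q : α → (Fin K → ℝ) → ℝ} (hq : ∀ a, Continuous (q a))
    (hq' : ∀ x, Continuous fun a => q a x) :
    Measurable fun a => ⨆ x : sparseBall K s, q a x :=
  (lowerSemicontinuous_ciSup (fun a => bddAbove_range_sparseBall (hq a)) fun x =>
    (hq' x).lowerSemicontinuous).measurable

theorem le_iSup_sparseBall {K s : ℕ} {q : (Fin K → ℝ) → ℝ} (hq : Continuous q) {x : Fin K → ℝ}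
    (hx : x ∈ sparseBall K s) : q x ≤ ⨆ x : sparseBall K s, q x :=
  le_ciSup (bddAbove_range_sparseBall hq) ⟨x, hx⟩

theorem exists_lt_of_lt_iSup_sparseBall {K s : ℕ} {q : (Fin K → ℝ) → ℝ} {r : ℝ}
    (h : r < ⨆ x : sparseBall K s, q x) : ∃ x ∈ sparseBall K s, r < q x := by
  have : Nonempty (sparseBall K s) := ⟨⟨0, zero_mem_sparseBall K s⟩⟩
  obtain ⟨x, hx⟩ := exists_lt_of_lt_ciSup h
  exact ⟨x, x.2, hx⟩

/-- Exchange the `i`-th coordinates of a pair of families whenever `ε i` is `false`. -/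
def swapAt {ι D : Type*} (ε : ι → Bool) (ω : (ι → D) × (ι → D)) : (ι → D) × (ι → D) :=
  (fun i => if ε i then ω.1 i else ω.2 i, fun i => if ε i then ω.2 i else ω.1 i)

theorem measurePreserving_swapAt {ι D : Type*} [Fintype ι] [MeasurableSpace D] (ν : Measure D)
    [IsProbabilityMeasure ν] (ε : ι → Bool) :
    MeasurePreserving (swapAt ε) ((Measure.pi fun _ : ι => ν).prod (Measure.pi fun _ : ι => ν))
      ((Measure.pi fun _ : ι => ν).prod (Measure.pi fun _ : ι => ν)) := by
  have h1 := measurePreserving_arrowProdEquivProdArrow D D ι (fun _ => ν) (fun _ => ν)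
  have h2 : MeasurePreserving (fun (a : ι → D × D) i => (if ε i then id else Prod.swap) (a i))
      (Measure.pi fun _ : ι => ν.prod ν) (Measure.pi fun _ : ι => ν.prod ν) := by
    refine measurePreserving_pi _ _ (f := fun i => if ε i then id else Prod.swap) fun i => ?_
    cases ε i
    · exact Measure.measurePreserving_swap
    · exact MeasurePreserving.id _
  convert! (h1.comp h2).comp (h1.symm) using 1
  funext ω
  refine Prod.ext (funext fun i => ?_) (funext fun i => ?_) <;>
    cases h : ε i <;>
    simp [swapAt, h, MeasurableEquiv.arrowProdEquivProdArrow, Equiv.arrowProdEquivProdArrow]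

open Classical in
/-- Averaging over coordinate exchanges bounds the measure of a set by the worst proportion of
exchanges landing in it. -/
theorem measureReal_le_of_card_swapAt_le {D : Type*} [MeasurableSpace D] (ν : Measure D)
    [IsProbabilityMeasure ν] {M : ℕ} {F : Set ((Fin M → D) × (Fin M → D))} (hF : MeasurableSet F)
    {q : ℝ}
    (h : ∀ ω, (#{ε : Fin M → Bool | swapAt ε ω ∈ F} : ℝ) ≤ q * 2 ^ M) :
    ((Measure.pi fun _ : Fin M => ν).prod (Measure.pi fun _ : Fin M => ν)).real F ≤ q := by
  set Q := (Measure.pi fun _ : Fin M => ν).prod (Measure.pi fun _ : Fin M => ν) with hQ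
  have h1 : ∀ ε : Fin M → Bool, ∫ ω, (swapAt ε ⁻¹' F).indicator (fun _ => (1 : ℝ)) ω ∂Q =
      Q.real F := fun ε => by
    have hm := measurePreserving_swapAt ν ε
    rw [integral_indicator_const _ (hm.measurable hF), smul_eq_mul, mul_one]
    exact congrArg ENNReal.toReal (hm.measure_preimage hF.nullMeasurableSet)
  have h2 : ∫ ω, ∑ ε : Fin M → Bool, (swapAt ε ⁻¹' F).indicator (fun _ => (1 : ℝ)) ω ∂Q =
      2 ^ M * Q.real F := by
    rw [integral_finsetSum]
    · simp [h1]
    · intro ε _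
      exact (integrable_const _).indicator ((measurePreserving_swapAt ν ε).measurable hF)
  have h3 : ∫ ω, ∑ ε : Fin M → Bool, (swapAt ε ⁻¹' F).indicator (fun _ => (1 : ℝ)) ω ∂Q ≤
      ∫ _, q * 2 ^ M ∂Q := by
    refine integral_mono_of_nonneg (Filter.Eventually.of_forall fun ω => ?_) (integrable_const _)
      (Filter.Eventually.of_forall fun ω => ?_)
    · exact Finset.sum_nonneg fun ε _ => Set.indicator_nonneg (fun _ _ => zero_le_one) _
    · refine le_trans (le_of_eq ?_) (h ω)
      simp [Set.indicator_apply, Finset.sum_boole]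
  rw [h2] at h3
  simp only [integral_const, probReal_univ, one_smul] at h3
  rw [mul_comm] at h3
  exact le_of_mul_le_mul_right h3 (by positivity)

/-- If a pair of independent copies is large in the first coordinate, then either the
exceptional set `F` occurs or the second coordinate falls outside a set of measure `3 / 4`. -/
theorem measureReal_lt_le_four_mul {Ω : Type*} [MeasurableSpace Ω] (P : Measure Ω)
    [IsProbabilityMeasure P] {Z : Ω → ℝ} (hZ : Measurable Z) {δ : ℝ} {F : Set (Ω × Ω)}
    (hF : MeasurableSet F)
    (h : ∀ X, δ < Z X → P.real {X' | Z X' ≤ Z X ∧ (X, X') ∉ F} ≤ 1 / 4) :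
    P.real {X | δ < Z X} ≤ 4 * (P.prod P).real F := by
  set Q := P.prod P with hQ
  set A : Set (Ω × Ω) := {ω | δ < Z ω.1 ∧ Z ω.2 ≤ Z ω.1} with hA
  have hZ1 : Measurable fun ω : Ω × Ω => Z ω.1 := hZ.comp measurable_fst
  have hZ2 : Measurable fun ω : Ω × Ω => Z ω.2 := hZ.comp measurable_snd
  have hAm : MeasurableSet A :=
    (measurableSet_lt measurable_const hZ1).inter (measurableSet_le hZ2 hZ1)
  have hEm : MeasurableSet {X | δ < Z X} := measurableSet_lt measurable_const hZ
  have h1 : P.real {X | δ < Z X} ≤ 2 * Q.real A := by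
    have e1 : Q.real (Prod.fst ⁻¹' {X | δ < Z X}) = P.real {X | δ < Z X} :=
      congrArg ENNReal.toReal (measurePreserving_fst.measure_preimage hEm.nullMeasurableSet)
    have e2 : Q.real (Prod.swap ⁻¹' A) = Q.real A :=
      congrArg ENNReal.toReal
        (Measure.measurePreserving_swap.measure_preimage hAm.nullMeasurableSet)
    have e3 : (Prod.fst ⁻¹' {X | δ < Z X} : Set (Ω × Ω)) ⊆ A ∪ Prod.swap ⁻¹' A := by
      rintro ⟨X, X'⟩ hX
      simp only [Set.mem_preimage, Set.mem_ofPred_eq] at hX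
      rcases le_total (Z X') (Z X) with h' | h'
      · exact Or.inl ⟨hX, h'⟩
      · exact Or.inr ⟨hX.trans_le h', h'⟩
    rw [← e1]
    refine (measureReal_mono e3).trans ((measureReal_union_le _ _).trans ?_)
    rw [e2]; linarith
  have h2 : Q.real (A \ F) ≤ 1 / 4 * P.real {X | δ < Z X} := by
    rw [measureReal_def, hQ, Measure.prod_apply (hAm.diff hF)]
    have h3 : ∀ X, P (Prod.mk X ⁻¹' (A \ F)) ≤
        {X | δ < Z X}.indicator (fun _ => ENNReal.ofReal (1 / 4)) X := by
      intro X
      by_cases hX : δ < Z X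
      · rw [Set.indicator_of_mem (by exact hX)]
        rw [ENNReal.le_ofReal_iff_toReal_le (measure_ne_top _ _) (by norm_num)]
        refine le_trans (measureReal_mono ?_) (h X hX)
        rintro X' ⟨⟨-, h'⟩, h''⟩
        exact ⟨h', h''⟩
      · rw [Set.indicator_of_notMem (by exact hX)]
        refine le_of_eq (measure_mono_null ?_ measure_empty)
        rintro X' ⟨⟨h', -⟩, -⟩
        exact hX h'
    have h4 := lintegral_mono h3 (μ := P)
    rw [lintegral_indicator_const hEm] at h4
    have h5 := ENNReal.toReal_mono (by finiteness) h4
    rwa [ENNReal.toReal_mul, ENNReal.toReal_ofReal (by norm_num)] at h5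
  have h6 : Q.real A ≤ Q.real F + Q.real (A \ F) := by
    refine le_trans (measureReal_mono ?_) (measureReal_union_le F (A \ F))
    rw [Set.union_sdiff_self]
    exact Set.subset_union_right
  linarith

/-- Chebyshev's inequality for sums of bounded i.i.d. samples. -/
theorem measureReal_abs_sum_sub_le {D : Type*} [MeasurableSpace D] (ν : Measure D)
    [IsProbabilityMeasure ν] {M : ℕ} {g : D → ℝ} (hg : Measurable g) {b r : ℝ}
    (hg0 : ∀ d, 0 ≤ g d) (hgb : ∀ d, g d ≤ b) (hm : ∫ d, g d ∂ν ≤ 1) (hb : 0 ≤ b)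
    (hr : 0 < r) :
    (Measure.pi fun _ : Fin M => ν).real {X | r ≤ |∑ i, g (X i) - M * ∫ d, g d ∂ν|} ≤
      M * b / r ^ 2 := by
  set P := Measure.pi fun _ : Fin M => ν with hP
  have hbd : ∀ d, ‖g d‖ ≤ b := fun d => by
    rw [Real.norm_eq_abs, abs_of_nonneg (hg0 d)]; exact hgb d
  have hLp : MemLp g 2 ν := MemLp.of_bound hg.aestronglyMeasurable b
    (Filter.Eventually.of_forall hbd)
  have hint : Integrable g ν := hLp.integrable (by norm_num)
  have hLi : ∀ i : Fin M, MemLp (fun X : Fin M → D => g (X i)) 2 P := fun i =>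
    MemLp.of_bound (hg.comp (measurable_pi_apply i)).aestronglyMeasurable b
      (Filter.Eventually.of_forall fun X => hbd _)
  have hvar : ProbabilityTheory.variance (∑ i : Fin M, fun X : Fin M → D => g (X i)) P =
      ∑ _i : Fin M, ProbabilityTheory.variance g ν :=
    ProbabilityTheory.variance_sum_pi (fun _ => hLp)
  have hv1 : ProbabilityTheory.variance g ν ≤ b := by
    refine (ProbabilityTheory.variance_le_expectation_sq hg.aestronglyMeasurable).trans ?_
    calc ∫ d, (g ^ 2) d ∂ν ≤ ∫ d, b * g d ∂ν := by
          refine integral_mono_of_nonneg (Filter.Eventually.of_forall fun d => sq_nonneg _)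
            (hint.const_mul b) (Filter.Eventually.of_forall fun d => ?_)
          simp only [Pi.pow_apply, sq]
          exact mul_le_mul_of_nonneg_right (hgb d) (hg0 d)
      _ ≤ b := by
          rw [integral_const_mul]
          nlinarith
  have hmean : ∫ X, (∑ i : Fin M, fun X : Fin M → D => g (X i)) X ∂P = M * ∫ d, g d ∂ν := by
    simp only [Finset.sum_apply]
    rw [integral_finsetSum _ fun i _ => (hLi i).integrable (by norm_num)]
    have : ∀ i : Fin M, ∫ X, g (X i) ∂P = ∫ d, g d ∂ν := fun i =>
      integral_comp_eval (μ := fun _ : Fin M => ν) (i := i) hg.aestronglyMeasurable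
    simp [this]
  have hch := ProbabilityTheory.meas_ge_le_variance_div_sq
    (memLp_finsetSum' univ fun i _ => hLi i) hr
  rw [hmean, hvar] at hch
  simp only [Finset.sum_apply, sum_const, card_univ, Fintype.card_fin, nsmul_eq_mul] at hch
  refine (ENNReal.toReal_le_of_le_ofReal ?_ hch).trans ?_
  · have := ProbabilityTheory.variance_nonneg g ν
    positivity
  · gcongr

theorem continuous_sum_sq_dotProduct {M K : ℕ} (v : Fin M → Fin K → ℝ) :
    Continuous fun x : Fin K → ℝ => ∑ i, (v i ⬝ᵥ x) ^ 2 := by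
  simp only [dotProduct]; fun_prop

theorem continuous_sum_sq_dotProduct' {M K : ℕ} (x : Fin K → ℝ) :
    Continuous fun v : Fin M → Fin K → ℝ => ∑ i, (v i ⬝ᵥ x) ^ 2 := by
  simp only [dotProduct]; fun_prop

theorem continuous_l2sq {K : ℕ} : Continuous fun x : Fin K → ℝ => l2sq x := by
  simp only [l2sq]; fun_prop

/-- The largest deviation of the empirical quadratic form from the identity over sparse unit
vectors. -/
noncomputable def sparseDeviation {M K : ℕ} (s : ℕ) (v : Fin M → Fin K → ℝ) : ℝ :=
  ⨆ x : sparseBall K s, |(∑ i, (v i ⬝ᵥ (x : Fin K → ℝ)) ^ 2) / M - l2sq (x : Fin K → ℝ)|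

theorem measurable_sparseDeviation {M K : ℕ} (s : ℕ) :
    Measurable (sparseDeviation s : (Fin M → Fin K → ℝ) → ℝ) :=
  measurable_iSup_sparseBall
    (q := fun (v : Fin M → Fin K → ℝ) x => |(∑ i, (v i ⬝ᵥ x) ^ 2) / M - l2sq x|)
    (fun v => (((continuous_sum_sq_dotProduct v).div_const _).sub continuous_l2sq).abs)
    fun x => (((continuous_sum_sq_dotProduct' x).div_const _).sub continuous_const).abs

theorem abs_sub_le_sparseDeviation {M K s : ℕ} (v : Fin M → Fin K → ℝ) {x : Fin K → ℝ}
    (hx : x ∈ sparseBall K s) :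
    |(∑ i, (v i ⬝ᵥ x) ^ 2) / M - l2sq x| ≤ sparseDeviation s v :=
  le_iSup_sparseBall (((continuous_sum_sq_dotProduct v).div_const _).sub continuous_l2sq).abs hx

theorem sum_sq_le_of_sparseDeviation_le {M K s : ℕ} (hM : 0 < M) (v : Fin M → Fin K → ℝ) {z : ℝ}
    (hz : sparseDeviation s v ≤ z) {x : Fin K → ℝ} (hx : x ∈ sparseBall K s) :
    ∑ i, (v i ⬝ᵥ x) ^ 2 ≤ M * (1 + z) := by
  have h1 := (le_abs_self _).trans ((abs_sub_le_sparseDeviation v hx).trans hz)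
  have hM' : (0 : ℝ) < M := by exact_mod_cast hM
  have h2 := hx.2
  rw [← div_le_iff₀' hM']
  linarith

/-- The matrix of values of the functions `ψ` at the sample points `X`. -/
def sampleMatrix {D : Type*} {M K : ℕ} (ψ : Fin K → D → ℝ) (X : Fin M → D) :
    Fin M → Fin K → ℝ := fun i j => ψ j (X i)

theorem measurable_sampleMatrix {D : Type*} [MeasurableSpace D] {M K : ℕ} {ψ : Fin K → D → ℝ}
    (hψ : ∀ j, Measurable (ψ j)) :
    Measurable (sampleMatrix ψ : (Fin M → D) → Fin M → Fin K → ℝ) :=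
  measurable_pi_lambda _ fun i => measurable_pi_lambda _ fun j =>
    (hψ j).comp (measurable_pi_apply i)

theorem integral_sq_dotProduct {D : Type*} [MeasurableSpace D] {ν : Measure D}
    [IsProbabilityMeasure ν] {K : ℕ} {ψ : Fin K → D → ℝ} {L : ℝ} (hψ : ∀ j, Measurable (ψ j))
    (horth : ∀ n m, ∫ ξ, ψ n ξ * ψ m ξ ∂ν = if n = m then 1 else 0)
    (hL : ∀ n ξ, |ψ n ξ| ≤ L) (x : Fin K → ℝ) :
    ∫ d, ((fun j => ψ j d) ⬝ᵥ x) ^ 2 ∂ν = l2sq x := by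
  have hint : ∀ n m, Integrable (fun d => ψ n d * ψ m d) ν := fun n m =>
    Integrable.of_bound ((hψ n).mul (hψ m)).aestronglyMeasurable (L * L)
      (Filter.Eventually.of_forall fun d => by
        rw [norm_mul]
        exact mul_le_mul (hL n d) (hL m d) (norm_nonneg _) ((abs_nonneg _).trans (hL n d)))
  have h1 : ∀ d, ((fun j => ψ j d) ⬝ᵥ x) ^ 2 =
      ∑ n, ∑ m, (x n * x m) * (ψ n d * ψ m d) := fun d => by
    rw [dotProduct, sq, Finset.sum_mul_sum]
    exact Finset.sum_congr rfl fun n _ => Finset.sum_congr rfl fun m _ => by ring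
  simp only [h1]
  rw [integral_finsetSum _ fun n _ => integrable_finsetSum _ fun m _ =>
    (hint n m).const_mul _]
  simp_rw [integral_finsetSum _ fun m _ => (hint _ m).const_mul _, integral_const_mul, horth]
  simp [l2sq, sq]

open Classical in
theorem card_lt_abs_sum_sub_le {M K s n : ℕ} (hs : 1 ≤ s) (hsK : s ≤ K) (hK : 2 ≤ K)
    (hn : 1 ≤ n) (hsn : s ≤ 2 ^ n) (v v' : Fin M → Fin K → ℝ) {L B : ℝ} (hL : 0 < L)
    (hv : ∀ i j, |v i j| ≤ L) (hv' : ∀ i j, |v' i j| ≤ L)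
    (hB : ∀ x ∈ sparseBall K s, ∑ i, (v i ⬝ᵥ x) ^ 2 + ∑ i, (v' i ⬝ᵥ x) ^ 2 ≤ B) :
    (#{ε : Fin M → Bool | ∃ x ∈ sparseBall K s,
        16128 * n * √(L ^ 2 * B * s * n * Real.log K) <
          |∑ i, boolSign (ε i) * ((v i ⬝ᵥ x) ^ 2 - (v' i ⬝ᵥ x) ^ 2)|} : ℝ) ≤
      4 * (n + 2) * Real.exp (-(16 * n ^ 3 * Real.log K)) * 2 ^ M := by
  have h1 := card_exists_lt_abs_sum_boolSign_le hs hsK hK hn hsn v hL hv (B := B) fun x hx =>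
    le_trans (le_add_of_nonneg_right (Finset.sum_nonneg fun i _ => sq_nonneg _)) (hB x hx)
  have h2 := card_exists_lt_abs_sum_boolSign_le hs hsK hK hn hsn v' hL hv' (B := B) fun x hx =>
    le_trans (le_add_of_nonneg_left (Finset.sum_nonneg fun i _ => sq_nonneg _)) (hB x hx)
  set R := √(L ^ 2 * B * s * n * Real.log K)
  have hsub : ({ε : Fin M → Bool | ∃ x ∈ sparseBall K s, 16128 * n * R <
      |∑ i, boolSign (ε i) * ((v i ⬝ᵥ x) ^ 2 - (v' i ⬝ᵥ x) ^ 2)|} : Finset _) ⊆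
      ({ε : Fin M → Bool | ∃ x ∈ sparseBall K s, 8064 * n * R <
        |∑ i, boolSign (ε i) * (v i ⬝ᵥ x) ^ 2|} : Finset _) ∪
      ({ε : Fin M → Bool | ∃ x ∈ sparseBall K s, 8064 * n * R <
        |∑ i, boolSign (ε i) * (v' i ⬝ᵥ x) ^ 2|} : Finset _) := by
    intro ε hε
    simp only [Finset.mem_filter, mem_univ, true_and, Finset.mem_union] at hε ⊢
    obtain ⟨x, hx, hlt⟩ := hε
    simp only [mul_sub, Finset.sum_sub_distrib] at hlt
    have h3 := hlt.trans_le (abs_sub _ _)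
    by_contra! hcon
    have h4 := hcon.1 x hx
    have h5 := hcon.2 x hx
    linarith
  have h3 := (Finset.card_le_card hsub).trans (Finset.card_union_le _ _)
  have h4 := Nat.cast_le (α := ℝ).2 h3
  push_cast at h4
  refine h4.trans ?_
  linarith

/-- Tail bound for the largest deviation of the empirical quadratic form of a bounded orthonormal
system over sparse unit vectors. -/
theorem measureReal_lt_sparseDeviation_le {D : Type*} [MeasurableSpace D] (ν : Measure D)
    [IsProbabilityMeasure ν] {M K s n : ℕ} {ψ : Fin K → D → ℝ} {L δ : ℝ}
    (hψ : ∀ j, Measurable (ψ j))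
    (horth : ∀ n m, ∫ ξ, ψ n ξ * ψ m ξ ∂ν = if n = m then 1 else 0)
    (hbd : ∀ n ξ, |ψ n ξ| ≤ L) (hL : 0 < L) (hs : 1 ≤ s) (hsK : s ≤ K) (hK : 2 ≤ K)
    (hn : 1 ≤ n) (hsn : s ≤ 2 ^ n) (hδ : 0 < δ) (hδ1 : δ < 1)
    (hM : 64 * (16128 ^ 2 * L ^ 2 * s * n ^ 3 * Real.log K) ≤ δ ^ 2 * M) :
    (Measure.pi fun _ : Fin M => ν).real {X | δ < sparseDeviation s (sampleMatrix ψ X)} ≤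
      16 * (n + 2) * Real.exp (-(16 * n ^ 3 * Real.log K)) := by
  classical
  have hℓ : 1 / 2 < Real.log K := by
    have h1 : Real.log 2 ≤ Real.log K :=
      Real.log_le_log (by norm_num) (by exact_mod_cast hK)
    linarith [Real.log_two_gt_d9]
  set ℓ := Real.log K with hℓdef
  have hs' : (1 : ℝ) ≤ s := by exact_mod_cast hs
  have hn' : (1 : ℝ) ≤ n := by exact_mod_cast hn
  have hMpos : (0 : ℝ) < M := by
    have : 0 < δ ^ 2 * (M : ℝ) := lt_of_lt_of_le (by positivity) hM
    exact pos_of_mul_pos_right this (by positivity)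
  have hMpos' : 0 < M := by exact_mod_cast hMpos
  set S : (Fin M → D) → Fin M → Fin K → ℝ := sampleMatrix ψ with hS
  have hSm : Measurable S := measurable_sampleMatrix hψ
  have hSb : ∀ X i j, |S X i j| ≤ L := fun X i j => hbd j (X i)
  let bq : (Fin M → Fin K → ℝ) × (Fin M → Fin K → ℝ) → (Fin K → ℝ) → ℝ := fun w x =>
    ∑ i, (w.1 i ⬝ᵥ x) ^ 2 + ∑ i, (w.2 i ⬝ᵥ x) ^ 2
  let gq : (Fin M → Fin K → ℝ) × (Fin M → Fin K → ℝ) → (Fin K → ℝ) → ℝ := fun w x =>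
    |∑ i, (w.1 i ⬝ᵥ x) ^ 2 - ∑ i, (w.2 i ⬝ᵥ x) ^ 2|
  have hb1 : ∀ w, Continuous (bq w) := fun w =>
    (continuous_sum_sq_dotProduct w.1).add (continuous_sum_sq_dotProduct w.2)
  have hb2 : ∀ x, Continuous fun w => bq w x := fun x =>
    ((continuous_sum_sq_dotProduct' x).comp continuous_fst).add
      ((continuous_sum_sq_dotProduct' x).comp continuous_snd)
  have hg1 : ∀ w, Continuous (gq w) := fun w =>
    ((continuous_sum_sq_dotProduct w.1).sub (continuous_sum_sq_dotProduct w.2)).abs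
  have hg2 : ∀ x, Continuous fun w => gq w x := fun x =>
    (((continuous_sum_sq_dotProduct' x).comp continuous_fst).sub
      ((continuous_sum_sq_dotProduct' x).comp continuous_snd)).abs
  let S₂ : (Fin M → D) × (Fin M → D) → (Fin M → Fin K → ℝ) × (Fin M → Fin K → ℝ) :=
    fun ω => (S ω.1, S ω.2)
  have hS₂ : Measurable S₂ := (hSm.comp measurable_fst).prodMk (hSm.comp measurable_snd)
  let Bt : (Fin M → D) × (Fin M → D) → ℝ := fun ω => ⨆ x : sparseBall K s, bq (S₂ ω) x
  let Gt : (Fin M → D) × (Fin M → D) → ℝ := fun ω => ⨆ x : sparseBall K s, gq (S₂ ω) x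
  have hBt : Measurable Bt := (measurable_iSup_sparseBall hb1 hb2).comp hS₂
  have hGt : Measurable Gt := (measurable_iSup_sparseBall hg1 hg2).comp hS₂
  let F : Set ((Fin M → D) × (Fin M → D)) :=
    {ω | 16128 * n * √(L ^ 2 * Bt ω * s * n * ℓ) < Gt ω}
  have hF : MeasurableSet F := measurableSet_lt (by fun_prop) hGt
  have hswap : ((Measure.pi fun _ : Fin M => ν).prod (Measure.pi fun _ : Fin M => ν)).real F ≤
      4 * (n + 2) * Real.exp (-(16 * n ^ 3 * ℓ)) := by
    refine measureReal_le_of_card_swapAt_le ν hF fun ω => ?_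
    refine le_trans ?_ (card_lt_abs_sum_sub_le hs hsK hK hn hsn (S ω.1) (S ω.2) hL (hSb _) (hSb _)
      (B := Bt ω) fun x hx => le_iSup_sparseBall (hb1 (S₂ ω)) hx)
    refine Nat.cast_le.2 (Finset.card_le_card fun ε hε => ?_)
    simp only [Finset.mem_filter, mem_univ, true_and] at hε ⊢
    have hrow : ∀ i x, (S (swapAt ε ω).1 i ⬝ᵥ x = if ε i then S ω.1 i ⬝ᵥ x else S ω.2 i ⬝ᵥ x) ∧
        (S (swapAt ε ω).2 i ⬝ᵥ x = if ε i then S ω.2 i ⬝ᵥ x else S ω.1 i ⬝ᵥ x) := by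
      intro i x
      have e : ∀ Y : Fin M → D, S Y i = fun j => ψ j (Y i) := fun _ => rfl
      cases h : ε i <;>
        simp only [e, swapAt, h, Bool.false_eq_true, if_false, if_true, and_self]
    have hBinv : Bt (swapAt ε ω) = Bt ω := by
      refine iSup_congr fun x => ?_
      simp only [bq, S₂, hrow, ← Finset.sum_add_distrib]
      refine Finset.sum_congr rfl fun i _ => ?_
      cases ε i <;> simp [add_comm]
    change 16128 * n * √(L ^ 2 * Bt (swapAt ε ω) * s * n * ℓ) < Gt (swapAt ε ω) at hε
    rw [hBinv] at hε
    obtain ⟨x, hx, hlt⟩ := exists_lt_of_lt_iSup_sparseBall hε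
    refine ⟨x, hx, hlt.trans_le (le_of_eq ?_)⟩
    simp only [gq, S₂, hrow, ← Finset.sum_sub_distrib]
    congr 1
    refine Finset.sum_congr rfl fun i _ => ?_
    cases ε i <;> simp [boolSign]
  have hZ : Measurable fun X => sparseDeviation s (S X) := (measurable_sparseDeviation s).comp hSm
  refine (measureReal_lt_le_four_mul (Measure.pi fun _ : Fin M => ν) hZ (δ := δ) hF
    fun X hX => ?_).trans (by linarith)
  set z := sparseDeviation s (S X) with hz
  have hz0 : 0 < z := hδ.trans hX
  obtain ⟨x, hx, hxz⟩ := exists_lt_of_lt_iSup_sparseBall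
    (q := fun x => |(∑ i, (S X i ⬝ᵥ x) ^ 2) / M - l2sq x|) (half_lt_self hz0)
  have hcheb := measureReal_abs_sum_sub_le ν (M := M) (g := fun d => ((fun j => ψ j d) ⬝ᵥ x) ^ 2)
    (b := L ^ 2 * s) (r := M * (δ / 4)) (by simp only [dotProduct]; fun_prop)
    (fun d => sq_nonneg _) (fun d => sq_dotProduct_le hx hL.le fun j => hbd j d)
    ((integral_sq_dotProduct hψ horth hbd x).trans_le hx.2) (by positivity) (by positivity)
  rw [integral_sq_dotProduct hψ horth hbd x] at hcheb
  refine le_trans (measureReal_mono ?_) (hcheb.trans ?_)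
  · rintro X' ⟨hX', hnot⟩
    by_contra hcon
    refine hnot ?_
    simp only [Set.mem_ofPred_eq, not_le] at hcon
    change |∑ i, (S X' i ⬝ᵥ x) ^ 2 - M * l2sq x| < M * (δ / 4) at hcon
    change 16128 * n * √(L ^ 2 * Bt (X, X') * s * n * ℓ) < Gt (X, X')
    have hB : Bt (X, X') ≤ 2 * M * (1 + z) := by
      have : Nonempty (sparseBall K s) := ⟨⟨0, zero_mem_sparseBall K s⟩⟩
      refine ciSup_le fun y => ?_
      have e1 := sum_sq_le_of_sparseDeviation_le hMpos' (S X) le_rfl y.2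
      have e2 := sum_sq_le_of_sparseDeviation_le hMpos' (S X') hX' y.2
      simp only [bq, S₂]
      linarith
    have hG : M * z / 4 < Gt (X, X') := by
      refine lt_of_lt_of_le ?_ (le_iSup_sparseBall (hg1 (S₂ (X, X'))) hx)
      have e1 : M * (z / 2) < |∑ i, (S X i ⬝ᵥ x) ^ 2 - M * l2sq x| := by
        have : ∑ i, (S X i ⬝ᵥ x) ^ 2 - M * l2sq x =
            M * ((∑ i, (S X i ⬝ᵥ x) ^ 2) / M - l2sq x) := by field_simp
        rw [this, abs_mul, abs_of_pos hMpos]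
        exact mul_lt_mul_of_pos_left hxz hMpos
      have e2 := abs_sub_le (∑ i, (S X i ⬝ᵥ x) ^ 2) (∑ i, (S X' i ⬝ᵥ x) ^ 2) (M * l2sq x)
      have e3 : M * (δ / 4) < M * (z / 4) := by gcongr
      simp only [gq, S₂]
      linarith
    refine lt_of_le_of_lt ?_ hG
    have hB' : L ^ 2 * Bt (X, X') * s * n * ℓ ≤ L ^ 2 * (2 * M * (1 + z)) * s * n * ℓ := by
      gcongr
    have hz1 : δ ^ 2 * (1 + z) ≤ 2 * z ^ 2 := by
      have e1 : δ ^ 2 ≤ z ^ 2 := by gcongr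
      have e2 : δ ^ 2 * z ≤ z ^ 2 * 1 := by
        calc δ ^ 2 * z = δ * z * δ := by ring
          _ ≤ δ * z * z := by gcongr
          _ = z ^ 2 * δ := by ring
          _ ≤ z ^ 2 * 1 := by gcongr
      linarith
    refine le_trans (mul_le_mul_of_nonneg_left (Real.sqrt_le_sqrt hB') (by positivity)) ?_
    refine abs_le_of_sq_le_sq' ?_ (by positivity) |>.2
    rw [mul_pow, Real.sq_sqrt (by positivity)]
    have e4 := mul_le_mul_of_nonneg_right hM (show 0 ≤ M * (1 + z) by positivity)
    have e5 := mul_le_mul_of_nonneg_left hz1 (show (0 : ℝ) ≤ M ^ 2 by positivity)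
    nlinarith
  · rw [div_le_iff₀ (by positivity)]
    have e1 : (1 / 2 : ℝ) ≤ n ^ 3 * ℓ := by
      have : (1 : ℝ) ≤ n ^ 3 := one_le_pow₀ hn'
      nlinarith
    have e2 : L ^ 2 * s ≤ 16128 ^ 2 * L ^ 2 * s * n ^ 3 * ℓ := by
      have := mul_le_mul_of_nonneg_left e1 (show 0 ≤ 16128 ^ 2 * L ^ 2 * (s : ℝ) by positivity)
      have h0 : 0 ≤ L ^ 2 * (s : ℝ) := by positivity
      nlinarith
    have e3 : 64 * (L ^ 2 * s) ≤ δ ^ 2 * M := by linarith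
    nlinarith

theorem exists_pow_two_log_bounds {s : ℕ} (hs : 2 ≤ s) :
    ∃ n : ℕ, 1 ≤ n ∧ s ≤ 2 ^ n ∧ Real.log s ≤ n ∧ (n : ℝ) ≤ 3 * Real.log s := by
  have hs0 : (0 : ℝ) < s := by positivity
  have hl2 := Real.log_two_gt_d9
  have hl2' := Real.log_two_lt_d9
  have hsn : s ≤ 2 ^ Nat.clog 2 s := Nat.le_pow_clog (by norm_num) s
  have hn : 1 ≤ Nat.clog 2 s := Nat.clog_pos (by norm_num) hs
  set n := Nat.clog 2 s with hndef
  have hn' : (1 : ℝ) ≤ n := by exact_mod_cast hn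
  refine ⟨n, hn, hsn, ?_, ?_⟩
  · have h1 : Real.log s ≤ Real.log (2 ^ n) := Real.log_le_log hs0 (by exact_mod_cast hsn)
    rw [Real.log_pow] at h1
    nlinarith
  · have h0 : Real.log 2 ≤ Real.log s := Real.log_le_log (by norm_num) (by exact_mod_cast hs)
    have h1 : 2 ^ (n - 1) < s := Nat.pow_pred_clog_lt_self (by norm_num) (by omega)
    have h2 : Real.log (2 ^ (n - 1)) ≤ Real.log s :=
      Real.log_le_log (by positivity) (by exact_mod_cast h1.le)
    rw [Real.log_pow, Nat.cast_sub hn, Nat.cast_one] at h2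
    nlinarith

theorem sixteen_mul_exp_le_rpow {K n : ℕ} (hK : 2 ≤ K) (hn : 1 ≤ n) {a : ℝ} (ha : a ≤ n ^ 3) :
    16 * (n + 2) * Real.exp (-(16 * n ^ 3 * Real.log K)) ≤ (K : ℝ) ^ (-a) := by
  have hK0 : (0 : ℝ) < K := by positivity
  have hℓ : 2 / 3 < Real.log K := by
    have h1 : Real.log 2 ≤ Real.log K := Real.log_le_log (by norm_num) (by exact_mod_cast hK)
    linarith [Real.log_two_gt_d9]
  have hn' : (1 : ℝ) ≤ n := by exact_mod_cast hn
  have hn3 : (n : ℝ) ≤ n ^ 3 := le_self_pow₀ hn' (by norm_num)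
  have h1 : 16 * ((n : ℝ) + 2) ≤ Real.exp (15 * n ^ 3 * Real.log K) := by
    have e1 : 10 * (n : ℝ) ≤ 15 * n ^ 3 * Real.log K := by nlinarith
    have e2 := Real.quadratic_le_exp_of_nonneg (show 0 ≤ 10 * (n : ℝ) by positivity)
    have e3 := Real.exp_le_exp.2 e1
    nlinarith
  calc 16 * (n + 2) * Real.exp (-(16 * n ^ 3 * Real.log K))
      ≤ Real.exp (15 * n ^ 3 * Real.log K) * Real.exp (-(16 * n ^ 3 * Real.log K)) := by gcongr
    _ = Real.exp (-(n ^ 3 * Real.log K)) := by rw [← Real.exp_add]; congr 1; ring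
    _ ≤ Real.exp (Real.log K * -a) := by
        refine Real.exp_le_exp.2 ?_
        have : 0 < Real.log K := by linarith
        nlinarith
    _ = (K : ℝ) ^ (-a) := by rw [Real.rpow_def_of_pos hK0]

theorem l0_le_card {n : Type*} [Fintype n] (x : n → ℝ) : l0 x ≤ Fintype.card n := by
  rw [← Nat.card_eq_fintype_card]
  exact Set.ncard_le_card _

theorem l2sq_div_sqrt {M K : ℕ} (v : Fin M → Fin K → ℝ) (c : Fin K → ℝ) :
    l2sq (fun i : Fin M => (∑ j, v i j * c j) / Real.sqrt M) = (∑ i, (v i ⬝ᵥ c) ^ 2) / M := by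
  simp only [l2sq, div_pow, Real.sq_sqrt (Nat.cast_nonneg M), ← Finset.sum_div, dotProduct]

theorem abs_sub_l2sq_le_of_sparseDeviation_le {M K s : ℕ} (v : Fin M → Fin K → ℝ) {δ : ℝ}
    (h : sparseDeviation s v ≤ δ) {c : Fin K → ℝ} (hc : l0 c ≤ s) :
    |(∑ i, (v i ⬝ᵥ c) ^ 2) / M - l2sq c| ≤ δ * l2sq c := by
  rcases (l2sq_nonneg c).eq_or_lt with h0 | h0
  · simp [eq_zero_of_l2sq_eq_zero h0.symm, l2sq]
  · have hr : 0 < √(l2sq c) := Real.sqrt_pos.2 h0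
    have hl : ∀ a : ℝ, l2sq (a • c) = a ^ 2 * l2sq c := fun a => by
      simp [l2sq, mul_pow, Finset.mul_sum]
    have hinv : ((√(l2sq c))⁻¹) ^ 2 = (l2sq c)⁻¹ := by rw [inv_pow, Real.sq_sqrt h0.le]
    have hy : (√(l2sq c))⁻¹ • c ∈ sparseBall K s := by
      refine ⟨(l0_le_of_support fun j hj => by simp [hj]).trans hc, le_of_eq ?_⟩
      rw [hl, hinv, inv_mul_cancel₀ h0.ne']
    have h1 := (abs_sub_le_sparseDeviation v hy).trans h
    simp only [hl, dotProduct_smul, smul_eq_mul, mul_pow, hinv, ← Finset.mul_sum] at h1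
    rw [mul_div_assoc, ← mul_sub, abs_mul, abs_of_pos (inv_pos.2 h0), inv_mul_le_iff₀ h0,
      mul_comm] at h1
    exact h1

theorem one_le_of_orthonormal_of_bounded {D : Type*} [MeasurableSpace D] {ν : Measure D}
    [IsProbabilityMeasure ν] {f : D → ℝ} {L : ℝ} (hf : ∫ ξ, f ξ * f ξ ∂ν = 1)
    (hL : ∀ ξ, |f ξ| ≤ L) (hL0 : 0 ≤ L) : 1 ≤ L := by
  have h1 : ∫ ξ, f ξ * f ξ ∂ν ≤ ∫ _, L ^ 2 ∂ν :=
    integral_mono_of_nonneg (Filter.Eventually.of_forall fun ξ => mul_self_nonneg _)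
      (integrable_const _) (Filter.Eventually.of_forall fun ξ => by
        simpa [sq] using mul_self_le_mul_self (abs_nonneg _) (hL ξ))
  rw [hf] at h1
  simp only [integral_const, probReal_univ, one_smul] at h1
  nlinarith

/-- RIP for random matrices from bounded orthonormal systems.
There are universal constants `C, β > 0` such that for any bounded orthonormal
system `{ψ_n}_{n < K}` on a probability space `(D, ν)` with uniform bound `L`, if
`M ≥ C δ⁻² L² s (log s)³ log K`, then with probability at least
`1 − K^{−β (log s)³}` over `M` i.i.d. samples from `ν`, the restricted isometry
constant `δ_s` of `(1/√M) Ψ` satisfies `δ_s ≤ δ`, where `Ψ_{ij} = ψ_j(ξ^{(i)})`. -/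
theorem bounded_orthonormal_system_rip :
    ∃ C β : ℝ, 0 < C ∧ 0 < β ∧
      ∀ (D : Type) (_ : MeasurableSpace D) (ν : Measure D), IsProbabilityMeasure ν →
      ∀ (K : ℕ) (ψ : Fin K → D → ℝ) (L : ℝ),
        (∀ n, Measurable (ψ n)) →
        -- orthonormality of the system with respect to `ν`:
        (∀ n m, ∫ ξ, ψ n ξ * ψ m ξ ∂ν = if n = m then 1 else 0) →
        -- uniform bound `L`:
        (∀ n ξ, |ψ n ξ| ≤ L) →
      ∀ (M s : ℕ) (δ : ℝ), 0 < δ → δ < 1 → 2 ≤ s →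
        C * δ⁻¹ ^ 2 * L ^ 2 * (s : ℝ) * (Real.log s) ^ 3 * Real.log K ≤ (M : ℝ) →
        ENNReal.ofReal (1 - (K : ℝ) ^ (-β * (Real.log s) ^ 3)) ≤
          (Measure.pi fun _ : Fin M => ν)
            {ξv : Fin M → D |
              -- the RIP constant `δ_s` of `(1/√M) Ψ` satisfies `δ_s ≤ δ`:
              ∀ c : Fin K → ℝ, l0 c ≤ s →
                (1 - δ) * l2sq c ≤
                    l2sq (fun i : Fin M => (∑ j, ψ j (ξv i) * c j) / Real.sqrt M) ∧
                  l2sq (fun i : Fin M => (∑ j, ψ j (ξv i) * c j) / Real.sqrt M) ≤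
                    (1 + δ) * l2sq c} := by
  refine ⟨64 * (16128 ^ 2 * 27), 1, by norm_num, one_pos, ?_⟩
  intro D _ ν hν K ψ L hψ horth hbd M s δ hδ hδ1 hs hM
  rcases Nat.lt_or_ge K 2 with hK | hK
  · interval_cases K
    · simp [l2sq]
      positivity
    · simp
  have hK0 : (0 : ℝ) < K := by positivity
  have hℓ : 0 < Real.log K := Real.log_pos (by exact_mod_cast hK)
  have hlogs : 0 < Real.log s := Real.log_pos (by exact_mod_cast hs)
  have hne : Nonempty D := by
    by_contra hcon
    have := not_nonempty_iff.1 hcon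
    exact one_ne_zero (hν.measure_univ.symm.trans (by simp [Set.univ_eq_empty_iff.2 this]))
  let j₀ : Fin K := ⟨0, by omega⟩
  have hL0 : 0 ≤ L := (abs_nonneg _).trans (hbd j₀ hne.some)
  have hL : 1 ≤ L := one_le_of_orthonormal_of_bounded (by simpa using horth j₀ j₀) (hbd j₀) hL0
  obtain ⟨n, hn, hsn, hn1, hn2⟩ := exists_pow_two_log_bounds hs
  have hmin : ((min s K : ℕ) : ℝ) ≤ s := by exact_mod_cast min_le_left s K
  have hn3 : (n : ℝ) ^ 3 ≤ 27 * Real.log s ^ 3 := by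
    calc (n : ℝ) ^ 3 ≤ (3 * Real.log s) ^ 3 := by gcongr
      _ = _ := by ring
  have htail := measureReal_lt_sparseDeviation_le ν (M := M) (s := min s K) (n := n) hψ horth hbd
    (by linarith) (by omega) (min_le_right _ _) hK hn ((min_le_left _ _).trans hsn) hδ hδ1 (by
      have h1 := mul_le_mul_of_nonneg_left hM (sq_nonneg δ)
      refine le_trans ?_ h1
      have h2 : δ ^ 2 * (64 * (16128 ^ 2 * 27) * δ⁻¹ ^ 2 * L ^ 2 * (s : ℝ) * (Real.log s) ^ 3 *
          Real.log K) = 64 * (16128 ^ 2 * L ^ 2 * s * (27 * Real.log s ^ 3) * Real.log K) := by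
        field_simp
      rw [h2]
      gcongr)
  have htail' := htail.trans (sixteen_mul_exp_le_rpow hK hn (a := Real.log s ^ 3) (by gcongr))
  set P := Measure.pi fun _ : Fin M => ν with hP
  have hmeas : MeasurableSet {X : Fin M → D | δ < sparseDeviation (min s K) (sampleMatrix ψ X)} :=
    measurableSet_lt measurable_const
      ((measurable_sparseDeviation _).comp (measurable_sampleMatrix hψ))
  have hcompl := probReal_compl_eq_one_sub (μ := P) hmeas
  refine le_trans (ENNReal.ofReal_le_of_le_toReal (b := P {X : Fin M → D |
    δ < sparseDeviation (min s K) (sampleMatrix ψ X)}ᶜ) ?_) (measure_mono ?_)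
  · change _ ≤ P.real _
    rw [hcompl, neg_one_mul]
    linarith
  · intro X hX c hc
    have hX' : sparseDeviation (min s K) (sampleMatrix ψ X) ≤ δ := not_lt.1 hX
    have h1 := abs_le.1 (abs_sub_l2sq_le_of_sparseDeviation_le _ hX'
      (le_min hc (by simpa using l0_le_card c)))
    have h2 := l2sq_div_sqrt (sampleMatrix ψ X) c
    simp only [sampleMatrix] at h1 h2
    rw [h2]
    constructor <;> linarith [h1.1, h1.2]
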